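/- arXiv:2208.14425 — 3 statements merged into one kernel-verified Lean document; each statement's English description precedes it below -/
import Mathlib

section
/- For all s ∈ [0, s_0), the generating function of ϖ satisfies Σ_{k≥0} ϖ(k) s^k = exp(−∫_0^s φ(u)/ψ(u) du); in particular (Σ_{k≥0} π(k) s^k)·(Σ_{k≥0} ϖ(k) s^k) = 1 for all s ∈ [0, s_0). -/
open Set Filter Topology

/-- A power series may be differentiated term by term inside its disc of convergence. -/
lemma hasDerivAt_tsum_mul_pow {a : ℕ → ℝ} {T : ℝ}
    (ha : ∀ r ∈ Ico (0 : ℝ) T, Summable fun k => ‖a k * r ^ k‖) {x : ℝ} (hx : |x| < T) :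
    HasDerivAt (fun y => ∑' k, a k * y ^ k) (∑' k, a k * (k * x ^ (k - 1))) x := by
  obtain ⟨t, hxt, htT⟩ := exists_between hx
  obtain ⟨r, htr, hrT⟩ := exists_between htT
  have ht : 0 < t := (abs_nonneg x).trans_lt hxt
  have hr : 0 < r := ht.trans htr
  have hu : Summable fun k : ℕ => ‖a k‖ * (k * t ^ (k - 1)) := by
    have hlim := tendsto_pow_const_mul_const_pow_of_abs_lt_one 1
      (show |t / r| < 1 by rwa [abs_of_pos (by positivity), div_lt_one hr])
    obtain ⟨M, hM⟩ := hlim.bddAbove_range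
    refine Summable.of_nonneg_of_le (fun k => by positivity) (fun k => ?_)
      ((ha r ⟨hr.le, hrT⟩).mul_left (M / t))
    have hk : (k : ℝ) * (t / r) ^ k ≤ M := by simpa using hM ⟨k, rfl⟩
    have hkt : (k : ℝ) * t ^ (k - 1) = (k * (t / r) ^ k) / t * r ^ k := by
      rcases k with _ | k
      · simp
      · rw [div_pow, Nat.add_sub_cancel]
        field_simp
        rw [pow_succ]
    rw [hkt, norm_mul, norm_pow, Real.norm_of_nonneg hr.le]
    calc ‖a k‖ * (k * (t / r) ^ k / t * r ^ k) ≤ ‖a k‖ * (M / t * r ^ k) := by gcongr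
      _ = M / t * (‖a k‖ * r ^ k) := by ring
  have hball : ∀ y ∈ Metric.ball (0 : ℝ) t, |y| ≤ t := fun y hy => by
    have := mem_ball_zero_iff.1 hy
    exact this.le
  refine hasDerivAt_tsum_of_isPreconnected (t := Metric.ball (0 : ℝ) t) (y₀ := 0) hu
    Metric.isOpen_ball (convex_ball _ _).isPreconnected
    (g := fun k y => a k * y ^ k) (g' := fun k y => a k * (k * y ^ (k - 1)))
    (fun k y _ => (hasDerivAt_pow k y).const_mul (a k)) (fun k y hy => ?_)
    (Metric.mem_ball_self ht) ?_ (mem_ball_zero_iff.2 hxt)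
  · rw [norm_mul, norm_mul, norm_pow, Real.norm_natCast, Real.norm_eq_abs y]
    gcongr
    exact hball y hy
  · exact (ha 0 ⟨le_rfl, hr.trans hrT⟩).of_norm

/-- The generating function of a convolution is the product of the generating functions. -/
lemma hasSum_convolution_mul_pow {a b : ℕ → ℝ} {s : ℝ}
    (ha : Summable fun k => ‖a k * s ^ k‖) (hb : Summable fun k => ‖b k * s ^ k‖) :
    HasSum (fun k => (∑ y ∈ Finset.range (k + 1), a (k - y) * b y) * s ^ k)
      ((∑' k, a k * s ^ k) * ∑' k, b k * s ^ k) := by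
  have h := hasSum_sum_range_mul_of_summable_norm hb ha
  rw [mul_comm] at h
  refine h.congr_fun fun k => ?_
  rw [Finset.sum_mul]
  refine Finset.sum_congr rfl fun y hy => ?_
  rw [← Nat.sub_add_cancel (Finset.mem_range_succ_iff.1 hy), pow_add, Nat.add_sub_cancel]
  ring

/-- The generating function of the tail of a probability measure on `ℕ`. -/
lemma hasSum_tail_mul_pow {w wbar : ℕ → ℝ} (hw : ∀ j, 0 ≤ w j) (hsum : ∑' j, w j = 1)
    (hbar : ∀ k, wbar k = 1 - ∑ j ∈ Finset.range (k + 1), w j) {s : ℝ} (hs : s ∈ Ico (0 : ℝ) 1) :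
    HasSum (fun k => wbar k * s ^ k) ((1 - ∑' j, w j * s ^ j) / (1 - s)) := by
  have hw' : Summable w := by
    by_contra h
    simp [tsum_eq_zero_of_not_summable h] at hsum
  have hgeom := hasSum_geometric_of_lt_one hs.1 hs.2
  have hws : Summable fun k => ‖w k * s ^ k‖ := by
    refine hw'.of_nonneg_of_le (fun k => norm_nonneg _) fun k => ?_
    rw [Real.norm_of_nonneg (mul_nonneg (hw k) (pow_nonneg hs.1 k))]
    exact mul_le_of_le_one_right (hw k) (pow_le_one₀ hs.1 hs.2.le)
  have h1 : Summable fun k => ‖(fun _ => 1 : ℕ → ℝ) k * s ^ k‖ := by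
    simpa [abs_of_nonneg hs.1] using hgeom.summable
  have h := hgeom.sub (hasSum_convolution_mul_pow h1 hws)
  simp only [one_mul, tsum_geometric_of_lt_one hs.1 hs.2] at h
  have hval : (1 - ∑' j, w j * s ^ j) / (1 - s) =
      (1 - s)⁻¹ - (1 - s)⁻¹ * ∑' j, w j * s ^ j := by ring
  rw [hval]
  exact h.congr_fun fun k => by rw [hbar k]; ring

lemma tail_nonneg {w wbar : ℕ → ℝ} (hw : ∀ j, 0 ≤ w j) (hsum : ∑' j, w j = 1)
    (hbar : ∀ k, wbar k = 1 - ∑ j ∈ Finset.range (k + 1), w j) (k : ℕ) : 0 ≤ wbar k := by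
  have hw' : Summable w := by
    by_contra h
    simp [tsum_eq_zero_of_not_summable h] at hsum
  rw [hbar, sub_nonneg, ← hsum]
  exact hw'.sum_le_tsum _ fun j _ => hw j

/-- The solution of a renewal equation whose kernel has total mass less than one is summable. -/
lemma summable_of_renewal {d e : ℕ → ℝ} (hd : ∀ k, 0 ≤ d k) (he : ∀ k, 0 ≤ e k)
    (hes : Summable e) (he1 : ∑' k, e k < 1)
    (hrec : ∀ k, d (k + 1) = ∑ j ∈ Finset.range (k + 1), d j * e (k - j)) : Summable d := by
  set r := ∑' k, e k
  have hr : 0 < 1 - r := sub_pos.2 he1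
  have hstep : ∀ N, ∑ k ∈ Finset.range N, d (k + 1) ≤ (∑ j ∈ Finset.range N, d j) * r := by
    intro N
    simp only [hrec]
    rw [Finset.sum_comm' (t' := Finset.range N) (s' := fun j => Finset.Ico j N)
      (by intro x y; simp only [Finset.mem_range, Finset.mem_Ico]; omega), Finset.sum_mul]
    refine Finset.sum_le_sum fun j _ => ?_
    rw [← Finset.mul_sum, Finset.sum_Ico_eq_sum_range]
    refine mul_le_mul_of_nonneg_left ?_ (hd j)
    simp only [Nat.add_sub_cancel_left]
    exact hes.sum_le_tsum _ fun i _ => he i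
  refine summable_of_sum_range_le (c := d 0 / (1 - r)) hd fun N => ?_
  rw [le_div_iff₀ hr]
  have h1 := Finset.sum_range_succ d N
  have h2 := Finset.sum_range_succ' d N
  nlinarith [hstep N, hd N]

/-- If `k + 1` times `a (k + 1)` is bounded by a convolution of `a` with a summable sequence,
then `a` is bounded. -/
lemma exists_forall_le_of_convolution {a b : ℕ → ℝ} (ha : ∀ k, 0 ≤ a k) (hb : ∀ k, 0 ≤ b k)
    (hbs : Summable b)
    (hrec : ∀ k : ℕ, (k + 1) * a (k + 1) ≤ ∑ y ∈ Finset.range (k + 1), a (k - y) * b y) :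
    ∃ M, ∀ k, a k ≤ M := by
  obtain ⟨N, hN⟩ := exists_nat_ge (∑' k, b k)
  set M := ∑ i ∈ Finset.range (N + 1), a i
  have hM : 0 ≤ M := Finset.sum_nonneg fun i _ => ha i
  refine ⟨M, fun k => ?_⟩
  induction k using Nat.strong_induction_on with
  | _ k ih =>
    rcases le_or_gt k N with hk | hk
    · exact Finset.single_le_sum (fun i _ => ha i) (Finset.mem_range_succ_iff.2 hk)
    · obtain ⟨k, rfl⟩ : ∃ m, k = m + 1 := ⟨k - 1, by omega⟩
      have hsum : ∑ y ∈ Finset.range (k + 1), a (k - y) * b y ≤ M * (k + 1) := by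
        calc ∑ y ∈ Finset.range (k + 1), a (k - y) * b y
            ≤ ∑ y ∈ Finset.range (k + 1), M * b y :=
              Finset.sum_le_sum fun y _ => mul_le_mul_of_nonneg_right (ih _ (by omega)) (hb y)
          _ = M * ∑ y ∈ Finset.range (k + 1), b y := (Finset.mul_sum _ _ _).symm
          _ ≤ M * (k + 1) := by
              refine mul_le_mul_of_nonneg_left ?_ hM
              have h1 := hbs.sum_le_tsum (Finset.range (k + 1)) fun i _ => hb i
              have h2 : (N : ℝ) < k + 1 := by exact_mod_cast hk
              linarith
      have hk0 : (0 : ℝ) < k + 1 := by positivity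
      nlinarith [hrec k]

lemma summable_norm_mul_pow_of_convolution {a κ : ℕ → ℝ} {T : ℝ} (hκ : ∀ k, 0 ≤ κ k)
    (hκs : ∀ r ∈ Ico (0 : ℝ) T, Summable fun k => ‖κ k * r ^ k‖)
    (ha : ∀ k : ℕ, (k + 1) * |a (k + 1)| ≤ |∑ y ∈ Finset.range (k + 1), a (k - y) * κ y|) :
    ∀ r ∈ Ico (0 : ℝ) T, Summable fun k => ‖a k * r ^ k‖ := by
  intro r hr
  obtain ⟨t, hrt, htT⟩ := exists_between hr.2
  have ht : 0 < t := hr.1.trans_lt hrt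
  obtain ⟨M, hM⟩ := exists_forall_le_of_convolution (a := fun k => |a k| * t ^ k)
    (b := fun k => t * (κ k * t ^ k)) (fun k => by positivity)
    (fun k => mul_nonneg ht.le (mul_nonneg (hκ k) (by positivity)))
    ((hκs t ⟨ht.le, htT⟩).of_norm.mul_left t) fun k => by
      calc ((k : ℝ) + 1) * (|a (k + 1)| * t ^ (k + 1))
          = ((k + 1) * |a (k + 1)|) * t ^ (k + 1) := by ring
        _ ≤ (∑ y ∈ Finset.range (k + 1), |a (k - y)| * κ y) * t ^ (k + 1) := by
            refine mul_le_mul_of_nonneg_right ((ha k).trans ?_) (by positivity)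
            refine (Finset.abs_sum_le_sum_abs _ _).trans_eq ?_
            simp only [abs_mul, abs_of_nonneg (hκ _)]
        _ = _ := by
            rw [Finset.sum_mul]
            refine Finset.sum_congr rfl fun y hy => ?_
            have : t ^ (k + 1) = t ^ (k - y) * t ^ y * t := by
              rw [← pow_add, Nat.sub_add_cancel (Finset.mem_range_succ_iff.1 hy), pow_succ]
            rw [this]; ring
  refine Summable.of_nonneg_of_le (fun k => norm_nonneg _) (fun k => ?_)
    ((summable_geometric_of_lt_one (div_nonneg hr.1 ht.le) ((div_lt_one ht).2 hrt)).mul_left M)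
  rw [norm_mul, norm_pow, Real.norm_of_nonneg hr.1, Real.norm_eq_abs]
  calc |a k| * r ^ k = |a k| * t ^ k * (r / t) ^ k := by rw [div_pow]; field_simp
    _ ≤ M * (r / t) ^ k :=
      mul_le_mul_of_nonneg_right (hM k) (pow_nonneg (div_nonneg hr.1 ht.le) k)

/-- The generating function of the solution of `(k + 1) a (k + 1) = σ (a ⋆ κ)(k)`. -/
lemma tsum_mul_pow_eq_exp {a κ : ℕ → ℝ} {σ T : ℝ} (hσ : |σ| = 1) (hκ : ∀ k, 0 ≤ κ k)
    (hκs : ∀ r ∈ Ico (0 : ℝ) T, Summable fun k => ‖κ k * r ^ k‖) (ha0 : a 0 = 1)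
    (ha : ∀ k : ℕ, (k + 1) * a (k + 1) = σ * ∑ y ∈ Finset.range (k + 1), a (k - y) * κ y) :
    ∀ s ∈ Ico (0 : ℝ) T,
      ∑' k, a k * s ^ k = Real.exp (σ * ∫ u in (0 : ℝ)..s, ∑' k, κ k * u ^ k) := by
  intro s hs
  have has := summable_norm_mul_pow_of_convolution hκ hκs (a := a) fun k => by
    have h := congrArg abs (ha k)
    rw [abs_mul, abs_mul, hσ, one_mul, abs_of_pos (by positivity : (0 : ℝ) < k + 1)] at h
    exact h.le
  have hsub : ∀ x ∈ Icc 0 s, x ∈ Ico (0 : ℝ) T := fun x hx => ⟨hx.1, hx.2.trans_lt hs.2⟩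
  have habs : ∀ x ∈ Icc 0 s, |x| < T := fun x hx => by
    rw [abs_of_nonneg hx.1]; exact (hsub x hx).2
  set K : ℝ → ℝ := fun x => ∑' k, κ k * x ^ k
  have hKcont : ContinuousOn K {x | |x| < T} := fun x hx =>
    (hasDerivAt_tsum_mul_pow hκs hx).continuousAt.continuousWithinAt
  have hopen : IsOpen {x : ℝ | |x| < T} := isOpen_lt continuous_abs continuous_const
  have hintK : ∀ x ∈ Icc 0 s, HasDerivAt (fun y => ∫ u in (0 : ℝ)..y, K u) (K x) x := by
    intro x hx
    refine intervalIntegral.integral_hasDerivAt_right ?_ ?_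
      (hKcont.continuousAt (hopen.mem_nhds (habs x hx)))
    · refine (hKcont.mono fun y hy => ?_).intervalIntegrable
      rw [uIcc_of_le hx.1] at hy
      exact habs y ⟨hy.1, hy.2.trans hx.2⟩
    · exact hKcont.stronglyMeasurableAtFilter hopen x (habs x hx)
  have hA : ∀ x ∈ Icc 0 s,
      HasDerivAt (fun y => ∑' k, a k * y ^ k) (σ * (K x * ∑' k, a k * x ^ k)) x := by
    intro x hx
    refine (hasDerivAt_tsum_mul_pow has (habs x hx)).congr_deriv ?_
    have h := (hasSum_convolution_mul_pow (has x (hsub x hx)) (hκs x (hsub x hx))).mul_left σ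
    have h' : HasSum (fun k => a (k + 1) * (((k + 1 : ℕ) : ℝ) * x ^ (k + 1 - 1)))
        (σ * ((∑' k, a k * x ^ k) * ∑' k, κ k * x ^ k)) := by
      refine h.congr_fun fun k => ?_
      rw [Nat.add_sub_cancel, ← mul_assoc, ← mul_assoc, ← ha k]
      push_cast; ring
    have hsum := (hasSum_nat_add_iff (f := fun k : ℕ => a k * (k * x ^ (k - 1))) 1).1 h'
    rw [hsum.tsum_eq]
    simp only [Finset.sum_range_one, Nat.cast_zero, zero_mul, mul_zero, add_zero]
    rw [mul_comm (K x)]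
  have hder : ∀ x ∈ Icc 0 s, HasDerivAt
      (fun y => (∑' k, a k * y ^ k) * Real.exp (-(σ * ∫ u in (0 : ℝ)..y, K u))) 0 x := by
    intro x hx
    refine ((hA x hx).mul ((hintK x hx).const_mul σ).neg.exp).congr_deriv ?_
    ring
  have hconst := constant_of_has_deriv_right_zero
    (fun x hx => (hder x hx).continuousAt.continuousWithinAt)
    (fun x hx => (hder x (Ico_subset_Icc_self hx)).hasDerivWithinAt) s ⟨hs.1, le_rfl⟩
  have hzero : ∑' k, a k * (0 : ℝ) ^ k = 1 := by
    rw [tsum_eq_single 0 fun k hk => by simp [hk]]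
    simp [ha0]
  simp only [hzero, intervalIntegral.integral_same, mul_zero, neg_zero, Real.exp_zero,
    mul_one] at hconst
  rwa [Real.exp_neg, ← div_eq_mul_inv, div_eq_one_iff_eq (Real.exp_ne_zero _)] at hconst



theorem stmt_8 (α p : ℝ) (μ : ℕ → ℝ) (ψ : ℝ → ℝ) (s₀ : ℝ)
    (hα : 0 < α) (hp : 0 ≤ p)
    (hμ_nonneg : ∀ j, 0 ≤ μ j) (hμ_sum : ∑' j, μ j = 1)
    (hμ0 : 0 < μ 0) (hμ1 : μ 1 = 0)
    (hψ : ∀ s : ℝ, ψ s = α * ((∑' j, μ j * s ^ j) - s) - p * s)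
    (hs₀ : s₀ = sInf {s : ℝ | 0 < s ∧ ψ s = 0})
    (hs₀_mem : s₀ ∈ Ioc (0:ℝ) 1)
    (hψ_pos : ∀ s ∈ Ico (0:ℝ) s₀, 0 < ψ s)
    (β q : ℝ) (ν : ℕ → ℝ) (φ : ℝ → ℝ)
    (hβ : 0 ≤ β) (hq : 0 ≤ q)
    (hν_nonneg : ∀ j, 0 ≤ ν j) (hν0 : ν 0 = 0) (hν_sum : ∑' j, ν j = 1)
    (hφ : ∀ s : ℝ, φ s = β * (1 - ∑' j, ν j * s ^ j) + q)
    (νbar : ℕ → ℝ)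
    (hνbar : ∀ k, νbar k = 1 - ∑ j ∈ Finset.range (k+1), ν j)
    (μbar : ℕ → ℝ)
    (hμbar : ∀ k, μbar k = 1 - ∑ j ∈ Finset.range (k+1), μ j)
    (ΔW : ℕ → ℝ)
    (hΔW0 : ΔW 0 = 1 / (α * μ 0))
    (hΔW : ∀ k, ΔW (k+1) = (1 / μ 0) * ∑ j ∈ Finset.range (k+1), ΔW j * (μbar (k - j + 1) + p / α))
    (W : ℕ → ℝ)
    (hW : ∀ k, W k = ∑ j ∈ Finset.range (k+1), ΔW j)
    (κ : ℕ → ℝ)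
    (hκ : ∀ k, κ k = β * (∑ y ∈ Finset.range (k+1), ΔW (k - y) * νbar y) + q * W k)
    (π : ℕ → ℝ)
    (hπ0 : π 0 = 1)
    (hπ : ∀ k, π (k+1) = (∑ y ∈ Finset.range (k+1), π (k - y) * κ y) / (k + 1 : ℝ))
    (ϖ : ℕ → ℝ)
    (hϖ0 : ϖ 0 = 1)
    (hϖ : ∀ k, ϖ (k+1) = -(∑ y ∈ Finset.range (k+1), ϖ (k - y) * κ y) / (k + 1 : ℝ)) :
    ∀ s ∈ Ico (0:ℝ) s₀,
      (∑' k, ϖ k * s ^ k = Real.exp (-∫ u in (0:ℝ)..s, φ u / ψ u)) ∧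
      (∑' k, π k * s ^ k) * (∑' k, ϖ k * s ^ k) = 1 := by

  have hs1 : ∀ s ∈ Ico (0 : ℝ) s₀, s ∈ Ico (0 : ℝ) 1 := fun s hs => ⟨hs.1, hs.2.trans_le hs₀_mem.2⟩
  have hμbar0 := tail_nonneg hμ_nonneg hμ_sum hμbar
  have hνbar0 := tail_nonneg hν_nonneg hν_sum hνbar
  have hc0 : ∀ k, 0 ≤ μbar (k + 1) + p / α := fun k => add_nonneg (hμbar0 _) (by positivity)
  have hΔW_nonneg : ∀ k, 0 ≤ ΔW k := by
    intro k
    induction k using Nat.strong_induction_on with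
    | _ k ih =>
      rcases k with _ | k
      · rw [hΔW0]; positivity
      · rw [hΔW]
        exact mul_nonneg (by positivity) (Finset.sum_nonneg fun j hj =>
          mul_nonneg (ih j (Finset.mem_range.1 hj)) (hc0 _))
  have hκ0 : ∀ k, 0 ≤ κ k := fun k => by
    rw [hκ, hW]
    exact add_nonneg
      (mul_nonneg hβ (Finset.sum_nonneg fun y _ => mul_nonneg (hΔW_nonneg _) (hνbar0 _)))
      (mul_nonneg hq (Finset.sum_nonneg fun j _ => hΔW_nonneg j))
  have hκsum : ∀ s ∈ Ico (0 : ℝ) s₀, HasSum (fun k => κ k * s ^ k) (φ s / ψ s) := by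
    intro s hs
    have hs' := hs1 s hs
    have h1s : 0 < 1 - s := sub_pos.2 hs'.2
    have hψs := hψ_pos s hs
    have hgeom := hasSum_geometric_of_lt_one hs'.1 hs'.2
    set C := ∑' k, (μbar (k + 1) + p / α) * s ^ k
    have hMtail := hasSum_tail_mul_pow hμ_nonneg hμ_sum hμbar hs'
    have hcs : Summable fun k => (μbar (k + 1) + p / α) * s ^ k := by
      have h0 : Summable fun k => μbar (k + 1) * s ^ k := by
        refine hgeom.summable.of_nonneg_of_le
          (fun k => mul_nonneg (hμbar0 _) (pow_nonneg hs'.1 k)) fun k =>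
          mul_le_of_le_one_left (pow_nonneg hs'.1 k) ?_
        rw [hμbar]
        exact sub_le_self _ (Finset.sum_nonneg fun j _ => hμ_nonneg j)
      simpa only [add_mul] using h0.add (hgeom.summable.mul_left (p / α))
    have hCψ : μ 0 - s * C = ψ s / (α * (1 - s)) := by
      have h := (hasSum_nat_add_iff' 1).2 hMtail
      have h2 := h.add ((hgeom.mul_left (p / α)).mul_left s)
      have h3 : HasSum (fun k => s * ((μbar (k + 1) + p / α) * s ^ k)) _ :=
        h2.congr_fun fun k => by ring
      have h4 := h3.unique (hcs.hasSum.mul_left s)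
      rw [← h4, hψ s]
      have : μbar 0 = 1 - μ 0 := by simp [hμbar]
      simp only [Finset.sum_range_one, pow_zero, this]
      field_simp
      ring
    have hpos : 0 < μ 0 - s * C := by rw [hCψ]; positivity
    have hΔWs : Summable fun k => ΔW k * s ^ k := by
      have he : HasSum (fun k => s / μ 0 * ((μbar (k + 1) + p / α) * s ^ k)) (s / μ 0 * C) :=
        hcs.hasSum.mul_left _
      refine summable_of_renewal (fun k => mul_nonneg (hΔW_nonneg k) (pow_nonneg hs'.1 k))
        (fun k => mul_nonneg (div_nonneg hs'.1 hμ0.le)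
          (mul_nonneg (hc0 k) (pow_nonneg hs'.1 k))) he.summable ?_ fun k => ?_
      · rw [he.tsum_eq, div_mul_eq_mul_div, div_lt_one hμ0]; linarith
      · rw [hΔW, Finset.mul_sum, Finset.sum_mul]
        refine Finset.sum_congr rfl fun j hj => ?_
        have : s ^ (k + 1) = s ^ (k - j) * s ^ j * s := by
          rw [← pow_add, Nat.sub_add_cancel (Finset.mem_range_succ_iff.1 hj), pow_succ]
        rw [this]; ring
    have hD : ∑' k, ΔW k * s ^ k = (1 - s) / ψ s := by
      set D := ∑' k, ΔW k * s ^ k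
      have h := (hasSum_convolution_mul_pow hcs.norm hΔWs.norm).mul_left (s / μ 0)
      have h' : HasSum (fun k => ΔW (k + 1) * s ^ (k + 1)) _ := h.congr_fun fun k => by
        rw [hΔW, pow_succ]
        simp only [mul_comm (ΔW _)]
        ring
      have h2 := h'.unique ((hasSum_nat_add_iff' 1).2 hΔWs.hasSum)
      simp only [Finset.sum_range_one, pow_zero, hΔW0, mul_one] at h2
      have h3 : D * (μ 0 - s * C) = 1 / α := by
        change s / μ 0 * (C * D) = D - 1 / (α * μ 0) at h2
        field_simp at h2 ⊢
        linarith
      rw [hCψ] at h3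
      field_simp at h3 ⊢
      linarith
    have hNtail := hasSum_tail_mul_pow hν_nonneg hν_sum hνbar hs'
    have h1 : Summable fun k => ‖(fun _ => 1 : ℕ → ℝ) k * s ^ k‖ := by
      simpa [abs_of_nonneg hs'.1] using hgeom.summable
    have hβsum := (hasSum_convolution_mul_pow hΔWs.norm hNtail.summable.norm).mul_left β
    have hqsum := (hasSum_convolution_mul_pow h1 hΔWs.norm).mul_left q
    simp only [one_mul, hgeom.tsum_eq, hNtail.tsum_eq, hD] at hβsum hqsum
    have hval : φ s / ψ s = β * ((1 - s) / ψ s * ((1 - ∑' j, ν j * s ^ j) / (1 - s))) +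
        q * ((1 - s)⁻¹ * ((1 - s) / ψ s)) := by
      rw [hφ]
      field_simp
    rw [hval]
    exact (hβsum.add hqsum).congr_fun fun k => by rw [hκ, hW]; ring
  have hκnorm : ∀ s ∈ Ico (0 : ℝ) s₀, Summable fun k => ‖κ k * s ^ k‖ :=
    fun s hs => (hκsum s hs).summable.norm
  intro s hs
  have hint : ∫ u in (0 : ℝ)..s, ∑' k, κ k * u ^ k = ∫ u in (0 : ℝ)..s, φ u / ψ u := by
    refine intervalIntegral.integral_congr fun u hu => ?_
    rw [uIcc_of_le hs.1] at hu
    exact (hκsum u ⟨hu.1, hu.2.trans_lt hs.2⟩).tsum_eq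
  have hϖs := tsum_mul_pow_eq_exp (σ := -1) (by simp) hκ0 hκnorm hϖ0
    (fun k => by rw [hϖ]; field_simp) s hs
  have hπs := tsum_mul_pow_eq_exp (σ := 1) (by simp) hκ0 hκnorm hπ0
    (fun k => by rw [hπ]; field_simp) s hs
  rw [hint, neg_one_mul] at hϖs
  rw [hint, one_mul] at hπs
  exact ⟨hϖs, by rw [hϖs, hπs, ← Real.exp_add, add_neg_cancel, Real.exp_zero]⟩
end

section
/- For each s ∈ [0, s_0), the function Φ_t(s) := π*[s]·ϖ*[Ψ_t(s)], where f*[v] = Σ_{k≥0} f(k) v^k denotes the generating function, satisfies Φ_0(s) = 1 and d/dt Φ_t(s) = −φ(Ψ_t(s)) Φ_t(s) for all t ≥ 0. -/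
open Set Filter Topology

/-- Weighting both factors of a convolution by powers of `x` weights the convolution. -/
theorem sum_conv_mul_pow (f g : ℕ → ℝ) (x : ℝ) (k : ℕ) :
    (∑ y ∈ Finset.range (k + 1), f (k - y) * g y) * x ^ k =
      ∑ y ∈ Finset.range (k + 1), (f (k - y) * x ^ (k - y)) * (g y * x ^ y) := by
  rw [Finset.sum_mul]
  refine Finset.sum_congr rfl fun y hy => ?_
  have hy' : y ≤ k := Nat.lt_succ_iff.mp (Finset.mem_range.mp hy)
  have : x ^ k = x ^ (k - y) * x ^ y := by rw [← pow_add, Nat.sub_add_cancel hy']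
  rw [this]
  ring

theorem sum_conv_le {u v : ℕ → ℝ} {M : ℝ} (hv : ∀ k, 0 ≤ v k) (hs : Summable v) (hM : 0 ≤ M)
    (k : ℕ) (hu : ∀ j ≤ k, u j ≤ M) :
    ∑ y ∈ Finset.range (k + 1), u (k - y) * v y ≤ M * ∑' y, v y := by
  calc ∑ y ∈ Finset.range (k + 1), u (k - y) * v y
      ≤ ∑ y ∈ Finset.range (k + 1), M * v y :=
        Finset.sum_le_sum fun y _ => mul_le_mul_of_nonneg_right (hu _ (Nat.sub_le _ _)) (hv y)
    _ = M * ∑ y ∈ Finset.range (k + 1), v y := by rw [Finset.mul_sum]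
    _ ≤ M * ∑' y, v y := mul_le_mul_of_nonneg_left (hs.sum_le_tsum _ fun i _ => hv i) hM

/-- The generating function of a convolution is the product of the generating functions. -/
theorem hasSum_conv_mul_pow {f g : ℕ → ℝ} {x : ℝ} (hf : Summable fun k => f k * x ^ k)
    (hg : Summable fun k => g k * x ^ k) :
    HasSum (fun k => (∑ y ∈ Finset.range (k + 1), f (k - y) * g y) * x ^ k)
      ((∑' k, f k * x ^ k) * ∑' k, g k * x ^ k) := by
  have e : (fun k => (∑ y ∈ Finset.range (k + 1), f (k - y) * g y) * x ^ k) =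
      fun k => ∑ y ∈ Finset.range (k + 1), (g y * x ^ y) * (f (k - y) * x ^ (k - y)) := by
    funext k
    rw [sum_conv_mul_pow]
    exact Finset.sum_congr rfl fun y _ => mul_comm _ _
  rw [e, mul_comm, tsum_mul_tsum_eq_tsum_sum_range_of_summable_norm hg.norm hf.norm]
  exact (summable_norm_sum_mul_range_of_summable_norm hg.norm hf.norm).of_norm.hasSum

/-- The generating function of the sequence of partial sums. -/
theorem hasSum_sum_range_mul_pow {f : ℕ → ℝ} {x : ℝ} (hf : Summable fun k => f k * x ^ k)
    (hx : |x| < 1) :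
    HasSum (fun k => (∑ j ∈ Finset.range (k + 1), f j) * x ^ k)
      ((∑' k, f k * x ^ k) / (1 - x)) := by
  have hg := hasSum_geometric_of_abs_lt_one hx
  have h := hasSum_conv_mul_pow (f := fun _ => 1) (by simpa using hg.summable) hf
  simpa [hg.tsum_eq, div_eq_inv_mul] using h

theorem summable_mul_pow_of_le_one {m : ℕ → ℝ} (hm : Summable m) {x : ℝ} (hx : |x| ≤ 1) :
    Summable fun k => m k * x ^ k := by
  refine Summable.of_norm_bounded hm.norm fun k => ?_
  rw [norm_mul, norm_pow]
  exact mul_le_of_le_one_right (norm_nonneg _) (pow_le_one₀ (norm_nonneg _) hx)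

/-- The generating function of the tail of a probability measure on `ℕ`. -/
theorem hasSum_tail_mul_pow_s12 {m mbar : ℕ → ℝ} (hm : Summable m)
    (hmbar : ∀ k, mbar k = 1 - ∑ j ∈ Finset.range (k + 1), m j) {x : ℝ} (hx : |x| < 1) :
    HasSum (fun k => mbar k * x ^ k) ((1 - ∑' k, m k * x ^ k) / (1 - x)) := by
  have h1 := hasSum_geometric_of_abs_lt_one hx
  have h2 := hasSum_sum_range_mul_pow (summable_mul_pow_of_le_one hm hx.le) hx
  have e : (fun k => mbar k * x ^ k) =
      fun k => x ^ k - (∑ j ∈ Finset.range (k + 1), m j) * x ^ k := by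
    funext k
    rw [hmbar]
    ring
  rw [e, sub_div, one_div]
  exact h1.sub h2

theorem tail_nonneg_s12 {m mbar : ℕ → ℝ} (hm : Summable m) (hnn : ∀ j, 0 ≤ m j)
    (hone : ∑' j, m j = 1)
    (hmbar : ∀ k, mbar k = 1 - ∑ j ∈ Finset.range (k + 1), m j) (k : ℕ) : 0 ≤ mbar k := by
  rw [hmbar, ← hone]
  exact sub_nonneg.mpr (hm.sum_le_tsum _ fun i _ => hnn i)

theorem summable_mul_pow_of_bound {a : ℕ → ℝ} {M r x : ℝ} (hM : ∀ n, |a n| * r ^ n ≤ M)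
    (hx : |x| < r) : Summable fun n => a n * x ^ n := by
  have hr : 0 < r := (abs_nonneg x).trans_lt hx
  have hq : |x| / r < 1 := (div_lt_one hr).mpr hx
  refine Summable.of_norm_bounded
    ((summable_geometric_of_lt_one (by positivity) hq).mul_left M) fun n => ?_
  calc ‖a n * x ^ n‖ = (|a n| * r ^ n) * (|x| / r) ^ n := by
        rw [norm_mul, norm_pow, Real.norm_eq_abs, Real.norm_eq_abs, div_pow]
        field_simp
    _ ≤ M * (|x| / r) ^ n := mul_le_mul_of_nonneg_right (hM n) (by positivity)

theorem hasDerivAt_tsum_mul_pow_s12 {a : ℕ → ℝ} {M r x : ℝ} (hM : ∀ n, |a n| * r ^ n ≤ M)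
    (hx : |x| < r) :
    HasDerivAt (fun z : ℝ => ∑' n, a n * z ^ n)
      (∑' n : ℕ, ((n + 1 : ℝ) * a (n + 1)) * x ^ n) x := by
  obtain ⟨ρ, hxρ, hρr⟩ := exists_between hx
  have hρ : 0 < ρ := (abs_nonneg x).trans_lt hxρ
  have hr : 0 < r := hρ.trans hρr
  have hq : ‖ρ / r‖ < 1 := by
    rw [Real.norm_of_nonneg (by positivity)]
    exact (div_lt_one hr).mpr hρr
  have hu : Summable fun n : ℕ => M / ρ * ((n : ℝ) ^ 1 * (ρ / r) ^ n) :=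
    (summable_pow_mul_geometric_of_norm_lt_one 1 hq).mul_left _
  have hb : ∀ n : ℕ, ∀ y ∈ Ioo (-ρ) ρ,
      ‖a n * (n * y ^ (n - 1))‖ ≤ M / ρ * ((n : ℝ) ^ 1 * (ρ / r) ^ n) := by
    intro n y hy
    rcases n with _ | n
    · simp
    have hy' : |y| ≤ ρ := (abs_lt.mpr hy).le
    calc ‖a (n + 1) * ((n + 1 : ℕ) * y ^ (n + 1 - 1))‖
        = |a (n + 1)| * ((n + 1 : ℕ) * |y| ^ n) := by
          rw [norm_mul, norm_mul, norm_pow, Real.norm_natCast]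
          rfl
      _ ≤ |a (n + 1)| * ((n + 1 : ℕ) * ρ ^ n) := by gcongr
      _ = (|a (n + 1)| * r ^ (n + 1)) * (1 / ρ * ((n + 1 : ℕ) * (ρ / r) ^ (n + 1))) := by
          rw [div_pow]
          field_simp
          rw [pow_succ, mul_assoc]
      _ ≤ M * (1 / ρ * ((n + 1 : ℕ) * (ρ / r) ^ (n + 1))) :=
          mul_le_mul_of_nonneg_right (hM _) (by positivity)
      _ = _ := by ring
  have hd := hasDerivAt_tsum_of_isPreconnected hu isOpen_Ioo isPreconnected_Ioo
    (fun n y _ => (hasDerivAt_pow n y).const_mul (a n)) hb (abs_lt.mp hxρ)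
    (summable_mul_pow_of_bound hM hx) (abs_lt.mp hxρ)
  refine hd.congr_deriv ?_
  have hs : Summable fun n : ℕ => a n * (n * x ^ (n - 1)) :=
    Summable.of_norm_bounded hu fun n => hb n x (abs_lt.mp hxρ)
  rw [hs.tsum_eq_zero_add]
  simp only [Nat.cast_zero, zero_mul, mul_zero, zero_add, Nat.add_sub_cancel]
  refine tsum_congr fun n => ?_
  push_cast
  ring

/-- A sequence solving `(k + 1) a (k + 1) = ± (a ⋆ κ) k` grows no faster than `r ^ (-k)`
whenever the generating function of `κ` converges at `r`. -/
theorem exists_bound_of_conv_recursion {a κ : ℕ → ℝ} {r : ℝ} (hκ : ∀ k, 0 ≤ κ k) (hr : 0 ≤ r)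
    (hs : Summable fun k => κ k * r ^ k)
    (ha : ∀ k : ℕ, (k + 1 : ℝ) * |a (k + 1)| ≤
      ∑ y ∈ Finset.range (k + 1), |a (k - y)| * κ y) :
    ∃ M, ∀ n, |a n| * r ^ n ≤ M := by
  set K := ∑' k, κ k * r ^ k
  obtain ⟨N, hN⟩ := exists_nat_ge (K * r)
  set M := ∑ j ∈ Finset.range (N + 1), |a j| * r ^ j
  have hnn : ∀ j, 0 ≤ |a j| * r ^ j := fun j => by positivity
  have hM0 : 0 ≤ M := Finset.sum_nonneg fun j _ => hnn j
  refine ⟨M, fun n => ?_⟩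
  induction n using Nat.strong_induction_on with
  | _ n ih =>
    rcases le_or_gt n N with h | h
    · exact Finset.single_le_sum (fun j _ => hnn j) (Finset.mem_range.mpr (Nat.lt_succ_of_le h))
    obtain ⟨k, rfl⟩ : ∃ k, n = k + 1 := ⟨n - 1, by omega⟩
    have h1 := sum_conv_le (u := fun j => |a j| * r ^ j) (fun y => mul_nonneg (hκ y) (by positivity))
      hs hM0 k fun j hj => ih j (by omega)
    rw [← sum_conv_mul_pow (fun j => |a j|)] at h1
    have h2 := mul_le_mul_of_nonneg_right (ha k) (pow_nonneg hr k)
    have h3 : (k + 1 : ℝ) * (|a (k + 1)| * r ^ (k + 1)) ≤ M * K * r := by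
      calc _ = ((k + 1 : ℝ) * |a (k + 1)| * r ^ k) * r := by ring
        _ ≤ M * K * r := mul_le_mul_of_nonneg_right (h2.trans h1) hr
    have h4 : K * r ≤ (k + 1 : ℝ) := hN.trans (by exact_mod_cast h.le)
    have h5 : (k + 1 : ℝ) * (|a (k + 1)| * r ^ (k + 1)) ≤ (k + 1 : ℝ) * M :=
      h3.trans (by nlinarith)
    exact le_of_mul_le_mul_left h5 (by positivity)

/-- The generating function of a solution of `(k + 1) a (k + 1) = c (a ⋆ κ) k`, `|c| ≤ 1`, solves
the differential equation `y' = c κ* y` on the disc of convergence of `κ*`. -/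
theorem hasDerivAt_tsum_of_conv_recursion {a κ : ℕ → ℝ} {R c : ℝ} (hκ : ∀ k, 0 ≤ κ k)
    (hs : ∀ r ∈ Ico 0 R, Summable fun k => κ k * r ^ k) (hc : |c| ≤ 1)
    (ha : ∀ k : ℕ, (k + 1 : ℝ) * a (k + 1) =
      c * ∑ y ∈ Finset.range (k + 1), a (k - y) * κ y) {x : ℝ} (hx : |x| < R) :
    HasDerivAt (fun z : ℝ => ∑' n, a n * z ^ n)
      (c * (∑' n, κ n * x ^ n) * ∑' n, a n * x ^ n) x := by
  obtain ⟨r, hxr, hrR⟩ := exists_between hx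
  have hr : 0 ≤ r := (abs_nonneg x).trans hxr.le
  obtain ⟨M, hM⟩ := exists_bound_of_conv_recursion (a := a) hκ hr (hs r ⟨hr, hrR⟩) fun k => by
    have hk : (k + 1 : ℝ) * |a (k + 1)| = |(k + 1 : ℝ) * a (k + 1)| := by
      rw [abs_mul, abs_of_nonneg (by positivity : (0 : ℝ) ≤ k + 1)]
    rw [hk, ha, abs_mul]
    calc _ ≤ 1 * |∑ y ∈ Finset.range (k + 1), a (k - y) * κ y| := by gcongr
      _ ≤ ∑ y ∈ Finset.range (k + 1), |a (k - y) * κ y| := by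
        rw [one_mul]
        exact Finset.abs_sum_le_sum_abs _ _
      _ = _ := Finset.sum_congr rfl fun y _ => by rw [abs_mul, abs_of_nonneg (hκ y)]
  refine (hasDerivAt_tsum_mul_pow_s12 hM hxr).congr_deriv ?_
  have hsκ : Summable fun k => κ k * x ^ k := by
    refine Summable.of_norm_bounded (hs |x| ⟨abs_nonneg x, hx⟩) fun k => le_of_eq ?_
    rw [norm_mul, norm_pow, Real.norm_of_nonneg (hκ k), Real.norm_eq_abs]
  have h := ((hasSum_conv_mul_pow (summable_mul_pow_of_bound hM hxr) hsκ).mul_left c).tsum_eq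
  rw [mul_assoc, mul_comm (∑' n, κ n * x ^ n), ← h]
  exact tsum_congr fun k => by rw [ha, mul_assoc]

/-- Solutions of `y' = κ* y` and `y' = -κ* y` started at `1` are reciprocal. -/
theorem tsum_mul_tsum_eq_one_of_conv_recursion {a b κ : ℕ → ℝ} {R : ℝ} (hκ : ∀ k, 0 ≤ κ k)
    (hs : ∀ r ∈ Ico 0 R, Summable fun k => κ k * r ^ k) (ha0 : a 0 = 1) (hb0 : b 0 = 1)
    (ha : ∀ k : ℕ, (k + 1 : ℝ) * a (k + 1) =
      1 * ∑ y ∈ Finset.range (k + 1), a (k - y) * κ y)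
    (hb : ∀ k : ℕ, (k + 1 : ℝ) * b (k + 1) =
      -1 * ∑ y ∈ Finset.range (k + 1), b (k - y) * κ y) {x : ℝ} (hx : |x| < R) :
    (∑' n, a n * x ^ n) * (∑' n, b n * x ^ n) = 1 := by
  have hd : ∀ y ∈ Ioo (-R) R,
      HasDerivAt (fun z : ℝ => (∑' n, a n * z ^ n) * (∑' n, b n * z ^ n)) 0 y := fun y hy => by
    have h1 := hasDerivAt_tsum_of_conv_recursion hκ hs (by simp) ha (abs_lt.mpr hy)
    have h2 := hasDerivAt_tsum_of_conv_recursion hκ hs (by simp) hb (abs_lt.mpr hy)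
    exact (h1.mul h2).congr_deriv (by ring)
  have hR : 0 < R := (abs_nonneg x).trans_lt hx
  have h := isOpen_Ioo.is_const_of_deriv_eq_zero isPreconnected_Ioo
    (fun y hy => (hd y hy).differentiableAt.differentiableWithinAt)
    (fun y hy => (hd y hy).deriv) (abs_lt.mp hx) (show (0 : ℝ) ∈ Ioo (-R) R by simpa using hR)
  have h0 : ∀ f : ℕ → ℝ, ∑' n, f n * (0 : ℝ) ^ n = f 0 := fun f => by
    rw [tsum_eq_single 0 fun n hn => by simp [hn]]
    simp
  simpa only [h0, ha0, hb0, mul_one] using h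

/-- Generating function of the solution of the renewal equation `D (k + 1) = (D ⋆ B) k`. -/
theorem summable_and_tsum_of_renewal {D B : ℕ → ℝ} {R : ℝ} (hB : ∀ k, 0 ≤ B k)
    (hs : ∀ x ∈ Ico 0 R, Summable fun k => B k * x ^ k)
    (h1 : ∀ x ∈ Ico 0 R, x * ∑' k, B k * x ^ k ≤ 1) (hD0 : 0 ≤ D 0)
    (hDnn : ∀ k, 0 ≤ D k)
    (hD : ∀ k, D (k + 1) = ∑ y ∈ Finset.range (k + 1), D (k - y) * B y) {x : ℝ}
    (hx : x ∈ Ico 0 R) :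
    Summable (fun k => D k * x ^ k) ∧
      (∑' k, D k * x ^ k) * (1 - x * ∑' k, B k * x ^ k) = D 0 := by
  obtain ⟨r, hxr, hrR⟩ := exists_between hx.2
  have hr : 0 ≤ r := hx.1.trans hxr.le
  have hbound : ∀ n, |D n| * r ^ n ≤ D 0 := fun n => by
    rw [abs_of_nonneg (hDnn n)]
    induction n using Nat.strong_induction_on with
    | _ n ih =>
      rcases n with _ | k
      · simp
      have h := sum_conv_le (u := fun j => D j * r ^ j)
        (fun y => mul_nonneg (hB y) (pow_nonneg hr y)) (hs r ⟨hr, hrR⟩) hD0 k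
        fun j hj => ih j (Nat.lt_succ_of_le hj)
      rw [← sum_conv_mul_pow, ← hD] at h
      calc D (k + 1) * r ^ (k + 1) = D (k + 1) * r ^ k * r := by ring
        _ ≤ D 0 * (∑' y, B y * r ^ y) * r := mul_le_mul_of_nonneg_right h hr
        _ = D 0 * (r * ∑' y, B y * r ^ y) := by ring
        _ ≤ D 0 := mul_le_of_le_one_right hD0 (h1 r ⟨hr, hrR⟩)
  have hsum : Summable fun k => D k * x ^ k :=
    summable_mul_pow_of_bound hbound (by rwa [abs_of_nonneg hx.1])
  refine ⟨hsum, ?_⟩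
  have h := ((hasSum_conv_mul_pow hsum (hs x hx)).mul_left x).tsum_eq
  have e : ∀ k, x * ((∑ y ∈ Finset.range (k + 1), D (k - y) * B y) * x ^ k) =
      D (k + 1) * x ^ (k + 1) := fun k => by
    rw [← hD]
    ring
  simp only [e] at h
  have h0 := hsum.tsum_eq_zero_add
  simp only [pow_zero, mul_one] at h0
  linarith

theorem nonneg_of_renewal {D B : ℕ → ℝ} (hB : ∀ k, 0 ≤ B k) (hD0 : 0 ≤ D 0)
    (hD : ∀ k, D (k + 1) = ∑ y ∈ Finset.range (k + 1), D (k - y) * B y) (n : ℕ) :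
    0 ≤ D n := by
  induction n using Nat.strong_induction_on with
  | _ n ih =>
    rcases n with _ | k
    · exact hD0
    rw [hD]
    exact Finset.sum_nonneg fun y _ => mul_nonneg (ih _ (by omega)) (hB y)

theorem summable_of_tsum_eq_one {m : ℕ → ℝ} (h : ∑' j, m j = 1) : Summable m := by
  by_contra hn
  rw [tsum_eq_zero_of_not_summable hn] at h
  exact zero_ne_one h

/-- The generating function of `ΔW` is `(1 - x) / ψ x`. -/
theorem scale_generating_function {α p s₀ : ℝ} {μ μbar ΔW : ℕ → ℝ} {ψ : ℝ → ℝ}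
    (hα : 0 < α) (hp : 0 ≤ p) (hμ_nonneg : ∀ j, 0 ≤ μ j) (hμ_sum : ∑' j, μ j = 1)
    (hμ0 : 0 < μ 0) (hψ : ∀ s : ℝ, ψ s = α * ((∑' j, μ j * s ^ j) - s) - p * s)
    (hs₀ : s₀ ≤ 1) (hψ_pos : ∀ s ∈ Ico (0:ℝ) s₀, 0 < ψ s)
    (hμbar : ∀ k, μbar k = 1 - ∑ j ∈ Finset.range (k+1), μ j)
    (hΔW0 : ΔW 0 = 1 / (α * μ 0))
    (hΔW : ∀ k, ΔW (k+1) = (1 / μ 0) *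
      ∑ j ∈ Finset.range (k+1), ΔW j * (μbar (k - j + 1) + p / α)) :
    (∀ k, 0 ≤ ΔW k) ∧ ∀ x ∈ Ico (0:ℝ) s₀,
      HasSum (fun k => ΔW k * x ^ k) ((1 - x) / ψ x) := by
  have hμs := summable_of_tsum_eq_one hμ_sum
  have hbar := tail_nonneg_s12 hμs hμ_nonneg hμ_sum hμbar
  set B : ℕ → ℝ := fun k => (1 / μ 0) * (μbar (k + 1) + p / α) with hBdef
  have hB : ∀ k, 0 ≤ B k := fun k => by
    have := hbar (k + 1)
    positivity
  have hD : ∀ k, ΔW (k + 1) = ∑ y ∈ Finset.range (k + 1), ΔW (k - y) * B y := fun k => by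
    rw [hΔW, Finset.mul_sum, ← Finset.sum_range_reflect]
    refine Finset.sum_congr rfl fun y hy => ?_
    have hy' : y ≤ k := Nat.lt_succ_iff.mp (Finset.mem_range.mp hy)
    rw [show k + 1 - 1 - y = k - y by omega, show k - (k - y) + 1 = y + 1 by omega]
    ring
  have hD0 : 0 ≤ ΔW 0 := by
    rw [hΔW0]
    positivity
  have habs : ∀ x ∈ Ico (0:ℝ) s₀, |x| < 1 := fun x hx => by
    rw [abs_of_nonneg hx.1]
    exact hx.2.trans_le hs₀
  have hle : ∀ k, B k ≤ (1 / μ 0) * (1 + p / α) := fun k => by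
    have : μbar (k + 1) ≤ 1 := by
      rw [hμbar]
      exact sub_le_self _ (Finset.sum_nonneg fun j _ => hμ_nonneg j)
    simp only [hBdef]
    gcongr
  have hBs : ∀ x ∈ Ico (0:ℝ) s₀, Summable fun k => B k * x ^ k := fun x hx =>
    summable_mul_pow_of_bound (r := 1) (M := (1 / μ 0) * (1 + p / α))
      (fun n => by rw [one_pow, mul_one, abs_of_nonneg (hB n)]; exact hle n) (habs x hx)
  have hBt : ∀ x ∈ Ico (0:ℝ) s₀,
      x * ∑' k, B k * x ^ k = 1 - ψ x / (α * μ 0 * (1 - x)) := fun x hx => by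
    have hx1 : 1 - x ≠ 0 := by linarith [hx.2]
    have h1 := (hasSum_nat_add_iff' 1).mpr (hasSum_tail_mul_pow_s12 hμs hμbar (habs x hx))
    have h2 := (hasSum_geometric_of_abs_lt_one (habs x hx)).mul_left (p / α * x)
    have h3 := ((h1.add h2).mul_left (1 / μ 0)).tsum_eq
    rw [← tsum_mul_left]
    calc _ = ∑' k, 1 / μ 0 * (μbar (k + 1) * x ^ (k + 1) + p / α * x * x ^ k) :=
          tsum_congr fun k => by simp only [hBdef]; ring
      _ = _ := by
        rw [h3, hψ]
        simp only [Finset.range_one, Finset.sum_singleton, hμbar 0, zero_add, pow_zero, mul_one]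
        field_simp
        ring
  have hnn := nonneg_of_renewal hB hD0 hD
  refine ⟨hnn, fun x hx => ?_⟩
  obtain ⟨h1, h2⟩ := summable_and_tsum_of_renewal hB hBs (fun y hy => by
    rw [hBt y hy]
    have h1 := hψ_pos y hy
    have h2 : 0 < 1 - y := by linarith [hy.2]
    have : 0 ≤ ψ y / (α * μ 0 * (1 - y)) := by positivity
    linarith) hD0 hnn hD hx
  have hψx := (hψ_pos x hx).ne'
  have hx1 : 1 - x ≠ 0 := by linarith [hx.2]
  rw [hBt x hx, hΔW0] at h2
  have h3 : ∑' k, ΔW k * x ^ k = (1 - x) / ψ x := by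
    field_simp at h2 ⊢
    linarith
  rw [← h3]
  exact h1.hasSum

/-- The generating function of `κ` is `φ / ψ`. -/
theorem kappa_generating_function {β q s₀ : ℝ} {ν νbar ΔW W κ : ℕ → ℝ} {φ ψ : ℝ → ℝ}
    (hβ : 0 ≤ β) (hq : 0 ≤ q) (hν_nonneg : ∀ j, 0 ≤ ν j) (hν_sum : ∑' j, ν j = 1)
    (hφ : ∀ s : ℝ, φ s = β * (1 - ∑' j, ν j * s ^ j) + q)
    (hνbar : ∀ k, νbar k = 1 - ∑ j ∈ Finset.range (k+1), ν j)
    (hs₀ : s₀ ≤ 1)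
    (hW : ∀ k, W k = ∑ j ∈ Finset.range (k+1), ΔW j)
    (hκ : ∀ k, κ k = β * (∑ y ∈ Finset.range (k+1), ΔW (k - y) * νbar y) + q * W k)
    (hnn : ∀ k, 0 ≤ ΔW k)
    (hΔ : ∀ x ∈ Ico (0:ℝ) s₀, HasSum (fun k => ΔW k * x ^ k) ((1 - x) / ψ x)) :
    (∀ k, 0 ≤ κ k) ∧ ∀ x ∈ Ico (0:ℝ) s₀, HasSum (fun k => κ k * x ^ k) (φ x / ψ x) := by
  have hνs := summable_of_tsum_eq_one hν_sum
  have hbar := tail_nonneg_s12 hνs hν_nonneg hν_sum hνbar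
  refine ⟨fun k => ?_, fun x hx => ?_⟩
  · rw [hκ, hW]
    exact add_nonneg
      (mul_nonneg hβ (Finset.sum_nonneg fun y _ => mul_nonneg (hnn _) (hbar y)))
      (mul_nonneg hq (Finset.sum_nonneg fun j _ => hnn j))
  have hxa : |x| < 1 := by
    rw [abs_of_nonneg hx.1]
    exact hx.2.trans_le hs₀
  have hx1 : 1 - x ≠ 0 := by linarith [hx.2]
  have ht := hasSum_tail_mul_pow_s12 hνs hνbar hxa
  have h1 := (hasSum_conv_mul_pow (hΔ x hx).summable ht.summable).mul_left β
  have h2 := (hasSum_sum_range_mul_pow (hΔ x hx).summable hxa).mul_left q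
  have e : (fun k => κ k * x ^ k) = fun k =>
      β * ((∑ y ∈ Finset.range (k + 1), ΔW (k - y) * νbar y) * x ^ k) +
        q * ((∑ j ∈ Finset.range (k + 1), ΔW j) * x ^ k) := by
    funext k
    rw [hκ, hW]
    ring
  have e' : φ x / ψ x = β * ((∑' k, ΔW k * x ^ k) * ∑' k, νbar k * x ^ k) +
      q * ((∑' k, ΔW k * x ^ k) / (1 - x)) := by
    rw [(hΔ x hx).tsum_eq, ht.tsum_eq, hφ]
    field_simp
  rw [e, e']
  exact h1.add h2

theorem continuousOn_tsum_mul_pow {m : ℕ → ℝ} (hm : ∀ j, 0 ≤ m j) (hs : Summable m) :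
    ContinuousOn (fun x : ℝ => ∑' j, m j * x ^ j) (Ioo (-1) 1) := fun x hx => by
  refine (hasDerivAt_tsum_mul_pow_s12 (r := 1) (M := ∑' j, m j) (fun n => ?_)
    (abs_lt.mpr hx)).continuousAt.continuousWithinAt
  rw [one_pow, mul_one, abs_of_nonneg (hm n)]
  exact hs.le_tsum n fun j _ => hm j

theorem hasDerivAt_integral_one_div {ψ : ℝ → ℝ} {s₀ : ℝ} (hs₀ : s₀ ≤ 1)
    (hc : ContinuousOn ψ (Ioo (-1) 1)) (hpos : ∀ s ∈ Ico (0:ℝ) s₀, 0 < ψ s) {x : ℝ}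
    (hx : x ∈ Ico (0:ℝ) s₀) :
    HasDerivAt (fun s => ∫ u in (0:ℝ)..s, 1 / ψ u) (1 / ψ x) x := by
  set U := Ioo (-1 : ℝ) 1 ∩ ψ ⁻¹' {0}ᶜ
  have hUo : IsOpen U := hc.isOpen_inter_preimage isOpen_Ioo isOpen_compl_singleton
  have hcU : ContinuousOn (fun u => 1 / ψ u) U :=
    continuousOn_const.div (hc.mono inter_subset_left) fun y hy => hy.2
  have hsub : ∀ y ∈ Ico (0:ℝ) s₀, y ∈ U := fun y hy =>
    ⟨⟨by linarith [hy.1], hy.2.trans_le hs₀⟩, (hpos y hy).ne'⟩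
  refine intervalIntegral.integral_hasDerivAt_right ?_
    (hcU.stronglyMeasurableAtFilter hUo x (hsub x hx))
    (hcU.continuousAt (hUo.mem_nhds (hsub x hx)))
  refine (hcU.mono fun y hy => ?_).intervalIntegrable
  rw [uIcc_of_le hx.1] at hy
  exact hsub y ⟨hy.1, hy.2.trans_lt hx.2⟩

/-- Derivative of a right inverse of a function with derivative `1 / ψ` for some `ψ ∈ (0, α]`. -/
theorem hasDerivWithinAt_right_inverse {Λ Λinv ψ : ℝ → ℝ} {α s₀ : ℝ} (hα : 0 < α)
    (hpos : ∀ s ∈ Ico (0:ℝ) s₀, 0 < ψ s) (hle : ∀ s ∈ Ico (0:ℝ) s₀, ψ s ≤ α)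
    (hΛ : ∀ x ∈ Ico (0:ℝ) s₀, HasDerivAt Λ (1 / ψ x) x)
    (hΛinv : ∀ t ∈ Ici (0:ℝ), Λinv t ∈ Ico 0 s₀ ∧ Λ (Λinv t) = t) {t : ℝ}
    (ht : t ∈ Ici (0:ℝ)) :
    HasDerivWithinAt Λinv (ψ (Λinv t)) (Ici 0) t := by
  have hmvt := (convex_Ico (0:ℝ) s₀).mul_sub_le_image_sub_of_le_deriv
    (fun x hx => (hΛ x hx).continuousAt.continuousWithinAt)
    (fun x hx => (hΛ x (interior_subset hx)).differentiableAt.differentiableWithinAt)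
    (C := 1 / α) fun x hx => by
      rw [(hΛ x (interior_subset hx)).deriv]
      exact one_div_le_one_div_of_le (hpos x (interior_subset hx)) (hle x (interior_subset hx))
  have key : ∀ x ∈ Ico (0:ℝ) s₀, ∀ y ∈ Ico (0:ℝ) s₀, x ≤ y → y - x ≤ α * |Λ y - Λ x| :=
    fun x hx y hy hxy => by
      have h := (hmvt x hx y hy hxy).trans (le_abs_self _)
      rw [one_div_mul_eq_div, div_le_iff₀ hα] at h
      linarith
  have hlip : LipschitzOnWith ⟨α, hα.le⟩ Λinv (Ici 0) :=
    LipschitzOnWith.of_dist_le_mul fun a ha b hb => by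
      obtain ⟨ha1, ha2⟩ := hΛinv a ha
      obtain ⟨hb1, hb2⟩ := hΛinv b hb
      rw [Real.dist_eq, Real.dist_eq]
      change |Λinv a - Λinv b| ≤ α * |a - b|
      rcases le_total (Λinv a) (Λinv b) with h | h
      · have := key _ ha1 _ hb1 h
        rwa [ha2, hb2, abs_sub_comm b, ← abs_of_nonneg (sub_nonneg.mpr h), abs_sub_comm] at this
      · have := key _ hb1 _ ha1 h
        rwa [ha2, hb2, ← abs_of_nonneg (sub_nonneg.mpr h)] at this
  obtain ⟨hm, -⟩ := hΛinv t ht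
  have hne : 1 / ψ (Λinv t) ≠ 0 := (one_div_pos.mpr (hpos _ hm)).ne'
  have hcont : Tendsto Λinv (𝓝[Ici 0] t) (𝓝[univ] Λinv t) := by
    rw [nhdsWithin_univ]
    exact hlip.continuousOn t ht
  have h := HasFDerivWithinAt.of_local_left_inverse hcont
    ((hΛ _ hm).hasFDerivAt_equiv hne).hasFDerivWithinAt ht
    (eventually_mem_nhdsWithin.mono fun u hu => (hΛinv u hu).2)
  have h' := h.hasDerivWithinAt
  simpa using h'

theorem stmt_12 (α p : ℝ) (μ : ℕ → ℝ) (ψ : ℝ → ℝ) (s₀ : ℝ)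
    (hα : 0 < α) (hp : 0 ≤ p)
    (hμ_nonneg : ∀ j, 0 ≤ μ j) (hμ_sum : ∑' j, μ j = 1)
    (hμ0 : 0 < μ 0) (hμ1 : μ 1 = 0)
    (hψ : ∀ s : ℝ, ψ s = α * ((∑' j, μ j * s ^ j) - s) - p * s)
    (hs₀ : s₀ = sInf {s : ℝ | 0 < s ∧ ψ s = 0})
    (hs₀_mem : s₀ ∈ Ioc (0:ℝ) 1)
    (hψ_pos : ∀ s ∈ Ico (0:ℝ) s₀, 0 < ψ s)
    (β q : ℝ) (ν : ℕ → ℝ) (φ : ℝ → ℝ)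
    (hβ : 0 ≤ β) (hq : 0 ≤ q)
    (hν_nonneg : ∀ j, 0 ≤ ν j) (hν0 : ν 0 = 0) (hν_sum : ∑' j, ν j = 1)
    (hφ : ∀ s : ℝ, φ s = β * (1 - ∑' j, ν j * s ^ j) + q)
    (νbar : ℕ → ℝ)
    (hνbar : ∀ k, νbar k = 1 - ∑ j ∈ Finset.range (k+1), ν j)
    (μbar : ℕ → ℝ)
    (hμbar : ∀ k, μbar k = 1 - ∑ j ∈ Finset.range (k+1), μ j)
    (ΔW : ℕ → ℝ)
    (hΔW0 : ΔW 0 = 1 / (α * μ 0))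
    (hΔW : ∀ k, ΔW (k+1) = (1 / μ 0) * ∑ j ∈ Finset.range (k+1), ΔW j * (μbar (k - j + 1) + p / α))
    (W : ℕ → ℝ)
    (hW : ∀ k, W k = ∑ j ∈ Finset.range (k+1), ΔW j)
    (κ : ℕ → ℝ)
    (hκ : ∀ k, κ k = β * (∑ y ∈ Finset.range (k+1), ΔW (k - y) * νbar y) + q * W k)
    (π : ℕ → ℝ)
    (hπ0 : π 0 = 1)
    (hπ : ∀ k, π (k+1) = (∑ y ∈ Finset.range (k+1), π (k - y) * κ y) / (k + 1 : ℝ))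
    (ϖ : ℕ → ℝ)
    (hϖ0 : ϖ 0 = 1)
    (hϖ : ∀ k, ϖ (k+1) = -(∑ y ∈ Finset.range (k+1), ϖ (k - y) * κ y) / (k + 1 : ℝ))
    (Λ : ℝ → ℝ)
    (hΛ : ∀ s : ℝ, Λ s = ∫ u in (0:ℝ)..s, 1 / ψ u)
    (Λinv : ℝ → ℝ)
    (hΛ_bij : BijOn Λ (Ico 0 s₀) (Ici 0))
    (hΛinv : ∀ t ∈ Ici (0:ℝ), Λinv t ∈ Ico 0 s₀ ∧ Λ (Λinv t) = t)
    (s : ℝ) (hs : s ∈ Ico (0:ℝ) s₀)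
    (Ψ : ℝ → ℝ) (hΨ : ∀ t : ℝ, Ψ t = Λinv (t + Λ s))
    (Φ : ℝ → ℝ)
    (hΦ : ∀ t : ℝ, Φ t = (∑' k, π k * s ^ k) * (∑' k, ϖ k * (Ψ t) ^ k)) :
    Φ 0 = 1 ∧ ∀ t ∈ Ici (0:ℝ), HasDerivWithinAt Φ (-φ (Ψ t) * Φ t) (Ici 0) t := by
  have hs₀1 : s₀ ≤ 1 := hs₀_mem.2
  have hμs := summable_of_tsum_eq_one hμ_sum
  obtain ⟨hΔnn, hΔ⟩ := scale_generating_function hα hp hμ_nonneg hμ_sum hμ0 hψ hs₀1 hψ_pos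
    hμbar hΔW0 hΔW
  obtain ⟨hκnn, hκs⟩ := kappa_generating_function hβ hq hν_nonneg hν_sum hφ hνbar hs₀1 hW hκ
    hΔnn hΔ
  have hκsum : ∀ r ∈ Ico 0 s₀, Summable fun k => κ k * r ^ k := fun r hr => (hκs r hr).summable
  have hπ' : ∀ k : ℕ, (k + 1 : ℝ) * π (k + 1) =
      1 * ∑ y ∈ Finset.range (k + 1), π (k - y) * κ y := fun k => by
    rw [hπ]
    field_simp
  have hϖ' : ∀ k : ℕ, (k + 1 : ℝ) * ϖ (k + 1) =
      -1 * ∑ y ∈ Finset.range (k + 1), ϖ (k - y) * κ y := fun k => by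
    rw [hϖ]
    field_simp
  have habs : ∀ x ∈ Ico (0:ℝ) s₀, |x| < s₀ := fun x hx => by
    rw [abs_of_nonneg hx.1]
    exact hx.2
  have hψc : ContinuousOn ψ (Ioo (-1) 1) := by
    rw [funext hψ]
    exact (continuousOn_const.mul
      ((continuousOn_tsum_mul_pow hμ_nonneg hμs).sub continuousOn_id)).sub
        (continuousOn_const.mul continuousOn_id)
  have hψle : ∀ x ∈ Ico (0:ℝ) s₀, ψ x ≤ α := fun x hx => by
    have hx1 : x ≤ 1 := hx.2.le.trans hs₀1
    have h : ∑' j, μ j * x ^ j ≤ 1 := by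
      rw [← hμ_sum]
      refine (summable_mul_pow_of_le_one hμs ?_).tsum_le_tsum (fun j => ?_) hμs
      · rwa [abs_of_nonneg hx.1]
      · exact mul_le_of_le_one_right (hμ_nonneg j) (pow_le_one₀ hx.1 hx1)
    rw [hψ]
    have h1 : α * ((∑' j, μ j * x ^ j) - x) ≤ α * 1 :=
      mul_le_mul_of_nonneg_left (by linarith [hx.1]) hα.le
    linarith [mul_nonneg hp hx.1]
  have hΛd : ∀ x ∈ Ico (0:ℝ) s₀, HasDerivAt Λ (1 / ψ x) x := fun x hx => by
    rw [funext hΛ]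
    exact hasDerivAt_integral_one_div hs₀1 hψc hψ_pos hx
  have hΛs : 0 ≤ Λ s := hΛ_bij.mapsTo hs
  have hadd : MapsTo (fun t : ℝ => t + Λ s) (Ici 0) (Ici 0) := fun t ht => add_nonneg ht hΛs
  refine ⟨?_, fun t ht => ?_⟩
  · have hΨ0 : Ψ 0 = s := by
      obtain ⟨h1, h2⟩ := hΛinv (Λ s) hΛs
      rw [hΨ, zero_add]
      exact hΛ_bij.injOn h1 hs h2
    rw [hΦ, hΨ0]
    exact tsum_mul_tsum_eq_one_of_conv_recursion hκnn hκsum hπ0 hϖ0 hπ' hϖ' (habs s hs)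
  · have hΨm : Ψ t ∈ Ico 0 s₀ := by
      rw [hΨ]
      exact (hΛinv _ (hadd ht)).1
    have hΨd : HasDerivWithinAt Ψ (ψ (Ψ t)) (Ici 0) t := by
      have h := (hasDerivWithinAt_right_inverse hα hψ_pos hψle hΛd hΛinv (hadd ht)).comp t
        ((hasDerivAt_id t).add_const (Λ s)).hasDerivWithinAt hadd
      rw [funext hΨ]
      simpa [Function.comp_def] using h
    have hϖd := hasDerivAt_tsum_of_conv_recursion hκnn hκsum (by simp) hϖ' (habs _ hΨm)
    have h := (hϖd.comp_hasDerivWithinAt t hΨd).const_mul (∑' k, π k * s ^ k)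
    rw [(hκs _ hΨm).tsum_eq] at h
    have hne := (hψ_pos _ hΨm).ne'
    rw [hΦ t, funext hΦ]
    refine h.congr_deriv ?_
    field_simp
end

section
/- For every x ≥ 0 and every s ∈ [0, s_0), Σ_{y≥0} 𝓗^{[y}(x) s^y = ∫_0^s (v^x/ψ(v)) · exp(∫_v^s φ(u)/ψ(u) du) dv. -/
open Set Filter Topology

/-- The sum of the real power series with coefficients `a`. -/
noncomputable def seriesSum (a : ℕ → ℝ) (x : ℝ) : ℝ := ∑' k, a k * x ^ k

/-- The Cauchy product of two coefficient sequences. -/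
noncomputable def cauchyProd (a b : ℕ → ℝ) (n : ℕ) : ℝ :=
  ∑ k ∈ Finset.range (n + 1), a k * b (n - k)

/-- The power series with coefficients `a` converges absolutely on `(-R, R)`. -/
def AbsConv (R : ℝ) (a : ℕ → ℝ) : Prop := ∀ x, |x| < R → Summable fun k => ‖a k * x ^ k‖

theorem AbsConv.of_nonneg {R : ℝ} {a : ℕ → ℝ}
    (h : ∀ x, 0 ≤ x → x < R → Summable fun k => |a k| * x ^ k) : AbsConv R a := by
  intro x hx
  simpa [norm_mul, norm_pow] using h |x| (abs_nonneg x) hx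

theorem AbsConv.mono {R R' : ℝ} {a : ℕ → ℝ} (h : AbsConv R a) (hR : R' ≤ R) : AbsConv R' a :=
  fun x hx => h x (hx.trans_le hR)

theorem AbsConv.summable {R x : ℝ} {a : ℕ → ℝ} (h : AbsConv R a) (hx : |x| < R) :
    Summable fun k => a k * x ^ k := (h x hx).of_norm

theorem AbsConv.add {R : ℝ} {a b : ℕ → ℝ} (ha : AbsConv R a) (hb : AbsConv R b) :
    AbsConv R fun k => a k + b k := by
  intro x hx
  refine Summable.of_nonneg_of_le (fun _ => norm_nonneg _) (fun k => ?_) ((ha x hx).add (hb x hx))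
  rw [add_mul]
  exact norm_add_le _ _

theorem AbsConv.const_mul {R : ℝ} {a : ℕ → ℝ} (c : ℝ) (ha : AbsConv R a) :
    AbsConv R fun k => c * a k := by
  intro x hx
  simpa [mul_assoc] using (ha x hx).mul_left |c|

theorem AbsConv.of_abs_le {R : ℝ} {a b : ℕ → ℝ} (hb : AbsConv R b) (h : ∀ k, |a k| ≤ |b k|) :
    AbsConv R a := by
  intro x hx
  refine Summable.of_nonneg_of_le (fun _ => norm_nonneg _) (fun k => ?_) (hb x hx)
  rw [norm_mul, norm_mul]
  exact mul_le_mul_of_nonneg_right (h k) (norm_nonneg _)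

theorem AbsConv.succ {R : ℝ} {a : ℕ → ℝ} (ha : AbsConv R a) : AbsConv R fun k => a (k + 1) := by
  intro x hx
  rcases eq_or_ne x 0 with rfl | hx0
  · refine summable_of_ne_finset_zero (s := {0}) fun k hk => ?_
    have : k ≠ 0 := by simpa using hk
    simp [this]
  · refine (((summable_nat_add_iff 1).2 (ha x hx)).mul_left |x|⁻¹).congr fun k => ?_
    have : |x| ≠ 0 := by simpa using hx0
    simp only [norm_mul, norm_pow, Real.norm_eq_abs, pow_succ]
    field_simp

theorem absConv_one : AbsConv 1 fun _ => 1 := by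
  intro x hx
  simpa using summable_geometric_of_lt_one (abs_nonneg x) hx

theorem AbsConv.of_summable {a : ℕ → ℝ} (ha0 : ∀ k, 0 ≤ a k) (ha : Summable a) : AbsConv 1 a := by
  refine AbsConv.of_nonneg fun x hx0 hx1 => ?_
  refine Summable.of_nonneg_of_le (fun k => by positivity) (fun k => ?_) ha
  rw [abs_of_nonneg (ha0 k)]
  exact mul_le_of_le_one_right (ha0 k) (pow_le_one₀ hx0 hx1.le)

theorem seriesSum_one {x : ℝ} (hx : |x| < 1) : seriesSum (fun _ => 1) x = (1 - x)⁻¹ := by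
  simp [seriesSum, tsum_geometric_of_abs_lt_one hx]

theorem seriesSum_add {R x : ℝ} {a b : ℕ → ℝ} (ha : AbsConv R a) (hb : AbsConv R b)
    (hx : |x| < R) :
    seriesSum (fun k => a k + b k) x = seriesSum a x + seriesSum b x := by
  simp only [seriesSum, add_mul]
  exact (ha.summable hx).tsum_add (hb.summable hx)

theorem seriesSum_const_mul (c x : ℝ) (a : ℕ → ℝ) :
    seriesSum (fun k => c * a k) x = c * seriesSum a x := by
  simp only [seriesSum, mul_assoc, tsum_mul_left]

theorem seriesSum_eq_zero_add {R x : ℝ} {a : ℕ → ℝ} (ha : AbsConv R a) (hx : |x| < R) :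
    seriesSum a x = a 0 + x * seriesSum (fun k => a (k + 1)) x := by
  rw [seriesSum, (ha.summable hx).tsum_eq_zero_add, seriesSum, ← tsum_mul_left]
  simp only [pow_zero, mul_one, pow_succ]
  congr 2
  funext k
  ring

theorem cauchyProd_mul_pow (a b : ℕ → ℝ) (x : ℝ) (n : ℕ) :
    cauchyProd a b n * x ^ n =
      ∑ k ∈ Finset.range (n + 1), (a k * x ^ k) * (b (n - k) * x ^ (n - k)) := by
  rw [cauchyProd, Finset.sum_mul]
  refine Finset.sum_congr rfl fun k hk => ?_
  have hk' : k ≤ n := Nat.lt_succ_iff.1 (Finset.mem_range.1 hk)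
  rw [← pow_mul_pow_sub x hk']
  ring

theorem AbsConv.mul {R : ℝ} {a b : ℕ → ℝ} (ha : AbsConv R a) (hb : AbsConv R b) :
    AbsConv R (cauchyProd a b) := by
  intro x hx
  refine (summable_norm_sum_mul_range_of_summable_norm (f := fun k => a k * x ^ k)
    (g := fun k => b k * x ^ k) (ha x hx) (hb x hx)).congr fun n => ?_
  rw [cauchyProd_mul_pow]

theorem seriesSum_cauchyProd {R x : ℝ} {a b : ℕ → ℝ} (ha : AbsConv R a) (hb : AbsConv R b)
    (hx : |x| < R) :
    seriesSum (cauchyProd a b) x = seriesSum a x * seriesSum b x := by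
  simp only [seriesSum, cauchyProd_mul_pow]
  exact (tsum_mul_tsum_eq_tsum_sum_range_of_summable_norm (ha x hx) (hb x hx)).symm

theorem AbsConv.continuousOn {R : ℝ} {a : ℕ → ℝ} (ha : AbsConv R a) :
    ContinuousOn (seriesSum a) (Ioo (-R) R) := by
  intro x hx
  obtain ⟨r, hxr, hrR⟩ := exists_between (abs_lt.2 hx)
  have hr0 : 0 < r := (abs_nonneg x).trans_lt hxr
  have hc : ContinuousOn (seriesSum a) (Ioo (-r) r) := by
    refine continuousOn_tsum (fun k => by fun_prop) (ha r (by rwa [abs_of_pos hr0])) ?_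
    intro k y hy
    rw [norm_mul, norm_mul, norm_pow, norm_pow, Real.norm_eq_abs r, abs_of_pos hr0]
    gcongr
    exact (abs_lt.2 hy).le
  exact (hc.continuousAt (Ioo_mem_nhds (abs_lt.1 hxr).1 (abs_lt.1 hxr).2)).continuousWithinAt

theorem AbsConv.integral_pow_mul {R x : ℝ} {a : ℕ → ℝ} (ha : AbsConv R a) (hx : |x| < R) (m : ℕ) :
    ∫ v in (0 : ℝ)..x, v ^ m * seriesSum a v = ∑' k, a k * x ^ (k + m + 1) / (k + m + 1) := by
  let f : ℕ → C(ℝ, ℝ) := fun k => ⟨fun v => a k * v ^ (k + m), by fun_prop⟩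
  have hs : Summable fun k =>
      ‖(f k).restrict (⟨uIcc 0 x, isCompact_uIcc⟩ : TopologicalSpace.Compacts ℝ)‖ := by
    refine Summable.of_nonneg_of_le (fun _ => norm_nonneg _) (fun k => ?_)
      ((ha x hx).mul_right (|x| ^ m))
    refine (ContinuousMap.norm_le _ (by positivity)).2 fun v => ?_
    have hv : |(v : ℝ)| ≤ |x| := by
      simpa using abs_sub_left_of_mem_uIcc v.2
    change ‖a k * (v : ℝ) ^ (k + m)‖ ≤ _
    simp only [norm_mul, norm_pow, Real.norm_eq_abs]
    rw [mul_assoc, ← pow_add]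
    gcongr
  have h := (intervalIntegral.hasSum_intervalIntegral_of_summable_norm hs).tsum_eq
  have h1 : ∀ v : ℝ, v ^ m * seriesSum a v = ∑' k, f k v := by
    intro v
    rw [seriesSum, ← tsum_mul_left]
    refine tsum_congr fun k => ?_
    change _ = a k * v ^ (k + m)
    ring
  simp only [h1]
  rw [← h]
  refine tsum_congr fun k => ?_
  change ∫ v in (0 : ℝ)..x, a k * v ^ (k + m) = _
  rw [intervalIntegral.integral_const_mul, integral_pow]
  push_cast
  simp
  ring

theorem hasDerivAt_integral_of_continuousOn_Ioo {R x : ℝ} {f : ℝ → ℝ} (hf : ContinuousOn f (Ioo (-R) R))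
    (hx : |x| < R) : HasDerivAt (fun t => ∫ v in (0 : ℝ)..t, f v) (f x) x := by
  have hx' : x ∈ Ioo (-R) R := abs_lt.1 hx
  have hR : 0 < R := (abs_nonneg x).trans_lt hx
  have hsub : uIcc 0 x ⊆ Ioo (-R) R :=
    ordConnected_Ioo.uIcc_subset ⟨by linarith, hR⟩ hx'
  exact intervalIntegral.integral_hasDerivAt_right
    (hf.mono hsub).intervalIntegrable
    (hf.stronglyMeasurableAtFilter isOpen_Ioo x hx')
    (hf.continuousAt (isOpen_Ioo.mem_nhds hx'))


theorem AbsConv.of_exp_recursion {R : ℝ} {a c : ℕ → ℝ} (hc : AbsConv R c)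
    (hrec : ∀ k, a (k + 1) = cauchyProd c a k / (k + 1)) : AbsConv R a := by
  refine AbsConv.of_nonneg fun x hx0 hxR => ?_
  obtain ⟨r, hxr, hrR⟩ := exists_between hxR
  have hr0 : 0 < r := hx0.trans_lt hxr
  have hcr : Summable fun k => ‖c k * r ^ k‖ := hc r (by rwa [abs_of_pos hr0])
  set C := ∑' k, ‖c k * r ^ k‖
  have hC : ∀ k, ‖c k * r ^ k‖ ≤ C := fun k => hcr.le_tsum k fun _ _ => norm_nonneg _
  have hC0 : 0 ≤ C := (norm_nonneg _).trans (hC 0)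
  set S : ℕ → ℝ := fun n => ∑ k ∈ Finset.range (n + 1), ‖a k * r ^ k‖ with hS
  have hS0 : ∀ n, 0 ≤ S n := fun n => Finset.sum_nonneg fun _ _ => norm_nonneg _
  have hstep : ∀ n, S (n + 1) ≤ (1 + r * C / (n + 1)) * S n := by
    intro n
    have hle : ‖cauchyProd c a n * r ^ n‖ ≤ C * S n := by
      rw [cauchyProd_mul_pow]
      refine (norm_sum_le _ _).trans ?_
      have hrefl := Finset.sum_range_reflect (fun k => ‖a k * r ^ k‖) (n + 1)
      simp only [Nat.add_sub_cancel] at hrefl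
      simp only [hS]
      rw [← hrefl, Finset.mul_sum]
      refine Finset.sum_le_sum fun k _ => ?_
      rw [norm_mul]
      exact mul_le_mul_of_nonneg_right (hC k) (norm_nonneg _)
    have hn : (0 : ℝ) < n + 1 := by positivity
    have hterm : ‖a (n + 1) * r ^ (n + 1)‖ = r / (n + 1) * ‖cauchyProd c a n * r ^ n‖ := by
      rw [hrec, pow_succ]
      simp only [norm_mul, norm_div, Real.norm_eq_abs, abs_of_pos hr0, abs_of_pos hn]
      ring
    calc S (n + 1) = S n + ‖a (n + 1) * r ^ (n + 1)‖ := Finset.sum_range_succ _ _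
      _ ≤ S n + r / (n + 1) * (C * S n) := by rw [hterm]; gcongr
      _ = _ := by ring
  set t := x / r with ht
  have ht0 : 0 ≤ t := by positivity
  have ht1 : t < 1 := (div_lt_one hr0).2 hxr
  have hsum : Summable fun n => S n * t ^ n := by
    refine summable_of_ratio_norm_eventually_le (r := (1 + t) / 2) (by linarith) ?_
    have hlim : Tendsto (fun n : ℕ => (1 + r * C * (1 / ((n : ℝ) + 1))) * t) atTop
        (𝓝 ((1 + r * C * 0) * t)) :=
      ((tendsto_one_div_add_atTop_nhds_zero_nat.const_mul (r * C)).const_add 1).mul_const t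
    simp only [mul_one_div] at hlim
    filter_upwards [hlim.eventually_le_const (u := (1 + t) / 2) (by linarith)] with n hn
    have h1 : 0 ≤ S n * t ^ n := mul_nonneg (hS0 n) (by positivity)
    have h2 : 0 ≤ S (n + 1) * t ^ (n + 1) := mul_nonneg (hS0 _) (by positivity)
    rw [Real.norm_of_nonneg h1, Real.norm_of_nonneg h2]
    calc S (n + 1) * t ^ (n + 1) ≤ ((1 + r * C / (n + 1)) * S n) * t ^ (n + 1) := by
          gcongr
          exact hstep n
      _ = ((1 + r * C / (n + 1)) * t) * (S n * t ^ n) := by ring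
      _ ≤ _ := by gcongr
  refine Summable.of_nonneg_of_le (fun k => by positivity) (fun k => ?_) hsum
  have hle : ‖a k * r ^ k‖ ≤ S k :=
    Finset.single_le_sum (f := fun k => ‖a k * r ^ k‖) (fun _ _ => norm_nonneg _)
      (Finset.mem_range.2 k.lt_succ_self)
  calc |a k| * x ^ k = ‖a k * r ^ k‖ * t ^ k := by
        rw [norm_mul, norm_pow, Real.norm_eq_abs, Real.norm_eq_abs, abs_of_pos hr0, ht, div_pow]
        field_simp
    _ ≤ _ := by gcongr

theorem seriesSum_exp_recursion {R x : ℝ} {a c : ℕ → ℝ} (hc : AbsConv R c) (ha0 : a 0 = 1)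
    (hrec : ∀ k, a (k + 1) = cauchyProd c a k / (k + 1)) (hx : |x| < R) :
    seriesSum a x = Real.exp (∫ v in (0 : ℝ)..x, seriesSum c v) := by
  have ha : AbsConv R a := hc.of_exp_recursion hrec
  have hca : AbsConv R (cauchyProd c a) := hc.mul ha
  have hR : 0 < R := (abs_nonneg x).trans_lt hx
  have hint : ∀ y, |y| < R →
      seriesSum a y = 1 + ∫ v in (0 : ℝ)..y, seriesSum (cauchyProd c a) v := by
    intro y hy
    have h := hca.integral_pow_mul hy 0
    simp only [pow_zero, one_mul] at h
    rw [h, seriesSum, (ha.summable hy).tsum_eq_zero_add, ha0]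
    simp only [pow_zero, mul_one]
    congr 2
    funext k
    rw [hrec]
    push_cast
    ring
  have hderiv : ∀ y ∈ Ioo (-R) R, HasDerivAt
      (fun y => (1 + ∫ v in (0 : ℝ)..y, seriesSum (cauchyProd c a) v) *
        Real.exp (-∫ v in (0 : ℝ)..y, seriesSum c v)) 0 y := by
    intro y hy
    have hy' := abs_lt.2 hy
    have h1 := (hasDerivAt_integral_of_continuousOn_Ioo hca.continuousOn hy').const_add 1
    have h2 := (hasDerivAt_integral_of_continuousOn_Ioo hc.continuousOn hy').neg.exp
    refine (h1.mul h2).congr_deriv ?_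
    rw [← hint y hy', seriesSum_cauchyProd hc ha hy']
    ring
  have hconst := isOpen_Ioo.is_const_of_deriv_eq_zero isPreconnected_Ioo
    (fun y hy => (hderiv y hy).differentiableAt.differentiableWithinAt)
    (fun y hy => (hderiv y hy).deriv) (abs_lt.1 hx) (show (0 : ℝ) ∈ Ioo (-R) R from ⟨by linarith, hR⟩)
  simp only [intervalIntegral.integral_same] at hconst
  rw [hint x hx]
  rw [Real.exp_neg, neg_zero, Real.exp_zero, add_zero, one_mul] at hconst
  field_simp at hconst
  exact hconst


theorem AbsConv.of_renewal {R m : ℝ} {a b : ℕ → ℝ} (ha0 : ∀ k, 0 ≤ a k) (hb0 : ∀ k, 0 ≤ b k)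
    (hm : 0 < m) (hrec : ∀ k, a (k + 1) = (1 / m) * cauchyProd a b k) (hb : AbsConv R b)
    (hlt : ∀ x, 0 ≤ x → x < R → x * seriesSum b x < m) : AbsConv R a := by
  refine AbsConv.of_nonneg fun x hx0 hxR => ?_
  simp only [abs_of_nonneg (ha0 _)]
  have hxb : |x| < R := by rwa [abs_of_nonneg hx0]
  set D : ℕ → ℝ := fun n => ∑ k ∈ Finset.range n, a k * x ^ k with hD
  have hterm : ∀ k, 0 ≤ a k * x ^ k := fun k => mul_nonneg (ha0 k) (by positivity)
  have hmono : ∀ n, D n ≤ D (n + 1) := fun n => by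
    simp only [hD, Finset.sum_range_succ]
    linarith [hterm n]
  have hD0 : ∀ n, 0 ≤ D n := fun n => Finset.sum_nonneg fun k _ => hterm k
  have hB0 : 0 ≤ seriesSum b x := tsum_nonneg fun k => mul_nonneg (hb0 k) (by positivity)
  have hconv : ∀ n, ∑ k ∈ Finset.range n, cauchyProd a b k * x ^ k ≤ D n * seriesSum b x := by
    intro n
    simp only [cauchyProd_mul_pow]
    rw [Finset.sum_range_diag_flip n fun i j => (a i * x ^ i) * (b j * x ^ j), hD, Finset.sum_mul]
    refine Finset.sum_le_sum fun i _ => ?_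
    rw [← Finset.mul_sum]
    refine mul_le_mul_of_nonneg_left ?_ (hterm i)
    exact (hb.summable hxb).sum_le_tsum _ fun k _ => mul_nonneg (hb0 k) (by positivity)
  have hpos : 0 < m - x * seriesSum b x := by linarith [hlt x hx0 hxR]
  refine summable_of_sum_range_le (c := m * a 0 / (m - x * seriesSum b x)) hterm fun n => ?_
  have hsucc : D (n + 1) = a 0 + x / m * ∑ k ∈ Finset.range n, cauchyProd a b k * x ^ k := by
    simp only [hD]
    rw [Finset.sum_range_succ', Finset.mul_sum, pow_zero, mul_one, add_comm]
    congr 1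
    refine Finset.sum_congr rfl fun k _ => ?_
    rw [hrec]
    ring
  have hle : m * D (n + 1) ≤ m * a 0 + x * (D (n + 1) * seriesSum b x) := by
    rw [show m * D (n + 1) = m * a 0 + x * ∑ k ∈ Finset.range n, cauchyProd a b k * x ^ k by
      rw [hsucc]; field_simp]
    gcongr
    exact (hconv n).trans (mul_le_mul_of_nonneg_right (hmono n) hB0)
  refine (hmono n).trans ?_
  rw [le_div_iff₀ hpos]
  linarith

theorem absConv_tail {a abar : ℕ → ℝ} (ha : AbsConv 1 a)
    (h : ∀ k, abar k = 1 - ∑ j ∈ Finset.range (k + 1), a j) : AbsConv 1 abar := by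
  have : abar = fun k => 1 + -1 * cauchyProd a (fun _ => 1) k := by
    funext k
    rw [h, cauchyProd]
    simp
    ring
  rw [this]
  exact absConv_one.add ((ha.mul absConv_one).const_mul (-1))

theorem seriesSum_tail {a abar : ℕ → ℝ} (ha : AbsConv 1 a)
    (h : ∀ k, abar k = 1 - ∑ j ∈ Finset.range (k + 1), a j) {x : ℝ} (hx : |x| < 1) :
    seriesSum abar x = (1 - seriesSum a x) / (1 - x) := by
  have : abar = fun k => 1 + -1 * cauchyProd a (fun _ => 1) k := by
    funext k
    rw [h, cauchyProd]
    simp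
    ring
  rw [this, seriesSum_add absConv_one ((ha.mul absConv_one).const_mul (-1)) hx,
    seriesSum_const_mul, seriesSum_cauchyProd ha absConv_one hx, seriesSum_one hx]
  ring

theorem tail_nonneg_s14 {a abar : ℕ → ℝ} (ha0 : ∀ k, 0 ≤ a k) (ha : ∑' k, a k = 1)
    (hs : Summable a) (h : ∀ k, abar k = 1 - ∑ j ∈ Finset.range (k + 1), a j) (k : ℕ) :
    0 ≤ abar k := by
  rw [h, ← ha]
  exact sub_nonneg.2 (hs.sum_le_tsum _ fun j _ => ha0 j)

theorem stmt_14 (α p : ℝ) (μ : ℕ → ℝ) (ψ : ℝ → ℝ) (s₀ : ℝ)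
    (hα : 0 < α) (hp : 0 ≤ p)
    (hμ_nonneg : ∀ j, 0 ≤ μ j) (hμ_sum : ∑' j, μ j = 1)
    (hμ0 : 0 < μ 0) (hμ1 : μ 1 = 0)
    (hψ : ∀ s : ℝ, ψ s = α * ((∑' j, μ j * s ^ j) - s) - p * s)
    (hs₀ : s₀ = sInf {s : ℝ | 0 < s ∧ ψ s = 0})
    (hs₀_mem : s₀ ∈ Ioc (0:ℝ) 1)
    (hψ_pos : ∀ s ∈ Ico (0:ℝ) s₀, 0 < ψ s)
    (β q : ℝ) (ν : ℕ → ℝ) (φ : ℝ → ℝ)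
    (hβ : 0 ≤ β) (hq : 0 ≤ q)
    (hν_nonneg : ∀ j, 0 ≤ ν j) (hν0 : ν 0 = 0) (hν_sum : ∑' j, ν j = 1)
    (hφ : ∀ s : ℝ, φ s = β * (1 - ∑' j, ν j * s ^ j) + q)
    (νbar : ℕ → ℝ)
    (hνbar : ∀ k, νbar k = 1 - ∑ j ∈ Finset.range (k+1), ν j)
    (μbar : ℕ → ℝ)
    (hμbar : ∀ k, μbar k = 1 - ∑ j ∈ Finset.range (k+1), μ j)
    (ΔW : ℕ → ℝ)
    (hΔW0 : ΔW 0 = 1 / (α * μ 0))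
    (hΔW : ∀ k, ΔW (k+1) = (1 / μ 0) * ∑ j ∈ Finset.range (k+1), ΔW j * (μbar (k - j + 1) + p / α))
    (W : ℕ → ℝ)
    (hW : ∀ k, W k = ∑ j ∈ Finset.range (k+1), ΔW j)
    (κ : ℕ → ℝ)
    (hκ : ∀ k, κ k = β * (∑ y ∈ Finset.range (k+1), ΔW (k - y) * νbar y) + q * W k)
    (π : ℕ → ℝ)
    (hπ0 : π 0 = 1)
    (hπ : ∀ k, π (k+1) = (∑ y ∈ Finset.range (k+1), π (k - y) * κ y) / (k + 1 : ℝ))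
    (ϖ : ℕ → ℝ)
    (hϖ0 : ϖ 0 = 1)
    (hϖ : ∀ k, ϖ (k+1) = -(∑ y ∈ Finset.range (k+1), ϖ (k - y) * κ y) / (k + 1 : ℝ))
    (H : ℕ → ℕ → ℝ)
    (hH : ∀ x y : ℕ, H x y = ∑ l ∈ Finset.range (y - x),
      π (y - x - 1 - l) * (∑ m ∈ Finset.range (l+1), W (l - m) * ϖ m) / (l + x + 1 : ℝ)) :
    ∀ (x : ℕ), ∀ s ∈ Ico (0:ℝ) s₀,
      ∑' y, H x y * s ^ y =
        ∫ v in (0:ℝ)..s, (v ^ x / ψ v) * Real.exp (∫ u in v..s, φ u / ψ u) := by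
  have hμs : Summable μ := by
    by_contra h
    simp [tsum_eq_zero_of_not_summable h] at hμ_sum
  have hνs : Summable ν := by
    by_contra h
    simp [tsum_eq_zero_of_not_summable h] at hν_sum
  have hs1 : s₀ ≤ 1 := hs₀_mem.2
  have hμc : AbsConv 1 μ := .of_summable hμ_nonneg hμs
  have hνc : AbsConv 1 ν := .of_summable hν_nonneg hνs
  have hμbc : AbsConv 1 μbar := absConv_tail hμc hμbar
  have hνbc : AbsConv 1 νbar := absConv_tail hνc hνbar
  have hμb0 := tail_nonneg_s14 hμ_nonneg hμ_sum hμs hμbar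
  set B : ℕ → ℝ := fun k => μbar (k + 1) + p / α * 1 with hB
  have hpc : AbsConv 1 fun _ => p / α * 1 := absConv_one.const_mul (p / α)
  have hBc : AbsConv 1 B := hμbc.succ.add hpc
  have hB0 : ∀ k, 0 ≤ B k := fun k => by
    have := hμb0 (k + 1)
    simp only [hB]
    positivity
  have hBsum : ∀ x, |x| < 1 → x * seriesSum B x = μ 0 - ψ x / (α * (1 - x)) := by
    intro x hx
    have hx1 : 0 < 1 - x := by linarith [(abs_lt.1 hx).2]
    have h1 : seriesSum B x = _ := seriesSum_add hμbc.succ hpc hx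
    have h2 := seriesSum_eq_zero_add hμbc hx
    rw [seriesSum_tail hμc hμbar hx, hμbar 0] at h2
    rw [seriesSum_const_mul, seriesSum_one hx] at h1
    have hψ' : ψ x = α * (seriesSum μ x - x) - p * x := hψ x
    have h3 : x * seriesSum (fun k => μbar (k + 1)) x
        = (1 - seriesSum μ x) / (1 - x) - (1 - μ 0) := by
      rw [h2]
      simp
    rw [h1, mul_add, h3, hψ']
    field_simp
    ring
  have hrecW : ∀ k, ΔW (k + 1) = 1 / μ 0 * cauchyProd ΔW B k := by
    intro k
    simp only [hΔW, cauchyProd, hB, mul_one]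
  have hΔW_nonneg : ∀ k, 0 ≤ ΔW k := by
    intro k
    induction k using Nat.strong_induction_on with
    | _ k ih =>
      cases k with
      | zero => rw [hΔW0]; positivity
      | succ k =>
        rw [hrecW]
        refine mul_nonneg (by positivity) (Finset.sum_nonneg fun j hj => ?_)
        exact mul_nonneg (ih j (Finset.mem_range.1 hj)) (hB0 _)
  have hΔWc : AbsConv s₀ ΔW := by
    refine .of_renewal hΔW_nonneg hB0 hμ0 hrecW (hBc.mono hs1) fun x hx0 hx => ?_
    have hx1 : 0 < 1 - x := by linarith
    rw [hBsum x (by rw [abs_of_nonneg hx0]; linarith)]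
    have := hψ_pos x ⟨hx0, hx⟩
    have : 0 < ψ x / (α * (1 - x)) := by positivity
    linarith
  have hΔWsum : ∀ x ∈ Ico 0 s₀, seriesSum ΔW x = (1 - x) / ψ x := by
    intro x hx
    have hxs : |x| < s₀ := by rw [abs_of_nonneg hx.1]; exact hx.2
    have hx1 : 0 < 1 - x := by linarith [hx.2]
    have hψx := hψ_pos x hx
    have h1 := seriesSum_eq_zero_add hΔWc hxs
    simp only [hrecW] at h1
    rw [seriesSum_const_mul, seriesSum_cauchyProd hΔWc (hBc.mono hs1) hxs, hΔW0] at h1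
    have h2 := hBsum x (hxs.trans_le hs1)
    have h3 : seriesSum ΔW x =
        1 / (α * μ 0) + 1 / μ 0 * seriesSum ΔW x * (x * seriesSum B x) := by
      exact h1.trans (by ring)
    rw [h2] at h3
    field_simp at h3 ⊢
    linarith
  have hone : AbsConv s₀ fun _ => 1 := absConv_one.mono hs1
  have hW' : W = cauchyProd ΔW fun _ => 1 := by
    funext k
    simp [hW, cauchyProd]
  have hWc : AbsConv s₀ W := hW' ▸ hΔWc.mul hone
  have hWsum : ∀ x ∈ Ico 0 s₀, seriesSum W x = 1 / ψ x := by
    intro x hx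
    have hxs : |x| < s₀ := by rw [abs_of_nonneg hx.1]; exact hx.2
    have hx1 : 0 < 1 - x := by linarith [hx.2]
    rw [hW', seriesSum_cauchyProd hΔWc hone hxs, hΔWsum x hx, seriesSum_one (hxs.trans_le hs1)]
    field_simp
  have hκ' : κ = fun k => β * cauchyProd νbar ΔW k + q * W k := by
    funext k
    simp only [hκ, cauchyProd, mul_comm (νbar _)]
  have hνΔc : AbsConv s₀ (cauchyProd νbar ΔW) := (hνbc.mono hs1).mul hΔWc
  have hκc : AbsConv s₀ κ := hκ' ▸ (hνΔc.const_mul β).add (hWc.const_mul q)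
  have hκsum : ∀ x ∈ Ico 0 s₀, seriesSum κ x = φ x / ψ x := by
    intro x hx
    have hxs : |x| < s₀ := by rw [abs_of_nonneg hx.1]; exact hx.2
    have hx1 : 0 < 1 - x := by linarith [hx.2]
    have hφ' : φ x = β * (1 - seriesSum ν x) + q := hφ x
    rw [hκ', seriesSum_add (hνΔc.const_mul β) (hWc.const_mul q) hxs, seriesSum_const_mul,
      seriesSum_const_mul, seriesSum_cauchyProd (hνbc.mono hs1) hΔWc hxs, hΔWsum x hx,
      hWsum x hx, seriesSum_tail hνc hνbar (hxs.trans_le hs1), hφ']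
    field_simp
  have hκnc : AbsConv s₀ fun k => -1 * κ k := hκc.const_mul (-1)
  have hπrec : ∀ k, π (k + 1) = cauchyProd κ π k / (k + 1) := by
    intro k
    simp only [hπ, cauchyProd, mul_comm (κ _)]
  have hϖrec : ∀ k, ϖ (k + 1) = cauchyProd (fun k => -1 * κ k) ϖ k / (k + 1) := by
    intro k
    simp only [hϖ, cauchyProd, ← Finset.sum_neg_distrib]
    congr 1
    exact Finset.sum_congr rfl fun _ _ => by ring
  have hπc : AbsConv s₀ π := hκc.of_exp_recursion hπrec
  have hϖc : AbsConv s₀ ϖ := hκnc.of_exp_recursion hϖrec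
  have hϖWc : AbsConv s₀ (cauchyProd ϖ W) := hϖc.mul hWc
  intro x s hs
  have hss : |s| < s₀ := by rw [abs_of_nonneg hs.1]; exact hs.2
  set b : ℕ → ℝ := fun l => cauchyProd ϖ W l / (l + x + 1) with hb
  have hbc : AbsConv s₀ b := by
    refine hϖWc.of_abs_le fun l => ?_
    have h1 : (1 : ℝ) ≤ l + x + 1 := by
      have : (0 : ℝ) ≤ l + x := by positivity
      linarith
    rw [hb, abs_div, abs_of_pos (zero_lt_one.trans_le h1)]
    exact div_le_self (abs_nonneg _) h1
  have hH' : ∀ n, H x (n + (x + 1)) = cauchyProd b π n := by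
    intro n
    rw [hH, show n + (x + 1) - x = n + 1 by omega]
    refine Finset.sum_congr rfl fun l _ => ?_
    simp only [hb, cauchyProd, Nat.add_sub_cancel, mul_comm (ϖ _)]
    ring
  have hH0 : ∀ y, y ≤ x → H x y = 0 := by
    intro y hy
    rw [hH, Nat.sub_eq_zero_of_le hy, Finset.sum_range_zero]
  have hbπ : AbsConv s₀ (cauchyProd b π) := hbc.mul hπc
  have hshift : ∀ n, H x (n + (x + 1)) * s ^ (n + (x + 1)) =
      s ^ (x + 1) * (cauchyProd b π n * s ^ n) := fun n => by
    rw [hH']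
    ring
  have hHs : Summable fun y => H x y * s ^ y := by
    refine (summable_nat_add_iff (x + 1)).1 ?_
    simp only [hshift]
    exact (hbπ.summable hss).mul_left _
  have hleft : ∑' y, H x y * s ^ y = seriesSum π s * (s ^ (x + 1) * seriesSum b s) := by
    have hz : ∑ y ∈ Finset.range (x + 1), H x y * s ^ y = 0 :=
      Finset.sum_eq_zero fun y hy => by
        rw [hH0 y (Nat.lt_succ_iff.1 (Finset.mem_range.1 hy)), zero_mul]
    rw [← hHs.sum_add_tsum_nat_add (x + 1), hz, zero_add]
    simp only [hshift]
    rw [tsum_mul_left]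
    change s ^ (x + 1) * seriesSum (cauchyProd b π) s = _
    rw [seriesSum_cauchyProd hbc hπc hss]
    ring
  have hmid : ∫ v in (0 : ℝ)..s, v ^ x * seriesSum (cauchyProd ϖ W) v =
      s ^ (x + 1) * seriesSum b s := by
    rw [hϖWc.integral_pow_mul hss x, seriesSum, ← tsum_mul_left]
    refine tsum_congr fun l => ?_
    simp only [hb]
    ring
  rw [hleft, ← hmid, ← intervalIntegral.integral_const_mul]
  refine intervalIntegral.integral_congr fun v hv => ?_
  rw [uIcc_of_le hs.1] at hv
  have hvI : v ∈ Ico 0 s₀ := ⟨hv.1, hv.2.trans_lt hs.2⟩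
  have hvs : |v| < s₀ := by rw [abs_of_nonneg hv.1]; exact hvI.2
  have hκint : ∀ y ∈ Ico 0 s₀,
      IntervalIntegrable (seriesSum κ) MeasureTheory.volume 0 y := by
    intro y hy
    refine (hκc.continuousOn.mono ?_).intervalIntegrable
    rw [uIcc_of_le hy.1]
    exact fun z hz => ⟨by linarith [hz.1, hs₀_mem.1], hz.2.trans_lt hy.2⟩
  have hφψ : ∫ u in v..s, φ u / ψ u =
      (∫ u in (0 : ℝ)..s, seriesSum κ u) - ∫ u in (0 : ℝ)..v, seriesSum κ u := by
    rw [intervalIntegral.integral_interval_sub_left (hκint s hs) (hκint v hvI)]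
    refine intervalIntegral.integral_congr fun u hu => ?_
    rw [uIcc_of_le hv.2] at hu
    exact (hκsum u ⟨hv.1.trans hu.1, hu.2.trans_lt hs.2⟩).symm
  have hϖexp := seriesSum_exp_recursion hκnc hϖ0 hϖrec hvs
  simp only [seriesSum_const_mul, intervalIntegral.integral_const_mul] at hϖexp
  rw [hφψ, seriesSum_cauchyProd hϖc hWc hvs, hWsum v hvI, hϖexp,
    seriesSum_exp_recursion hκc hπ0 hπrec hss, sub_eq_add_neg, Real.exp_add, neg_one_mul]
  ring
end
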